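/- There is an absolute constant C > 0 such that for every ε > 0 there exists n₀ with the following property: for every n ≥ n₀, if Γ is a connected Cayley graph on a finite abelian group F of order 2n with symmetric generating set D (D = −D, 0 ∉ D, D generates F) of size d ≥ C · (log n) · (log log n)^{11}, then the number of independent sets of Γ satisfies i(Γ) ≤ (1 + ε) · 2^{n+1}. -/

import Mathlib

open Pointwise Real

/-- The number of independent sets of a finite simple graph (including the empty set). -/
noncomputable def numIndSets {V : Type*} [Fintype V] (G : SimpleGraph V) : ℕ :=
  Nat.card {s : Set V // ∀ ⦃u v : V⦄, u ∈ s → v ∈ s → ¬ G.Adj u v}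

/-- The Cayley graph of an abelian group with generator set `D`: `u ~ v` iff `v - u ∈ D`
(for `D` symmetric with `0 ∉ D`). -/
def cayleyGraph {F : Type*} [AddCommGroup F] (D : Set F) : SimpleGraph F :=
  SimpleGraph.fromRel (fun u v => v - u ∈ D)

namespace ACG

set_option linter.unusedSectionVars false

open Finset

/-- Even balls: `bl D k` is the twice-k-fold sumset of `D`. -/
def bl {F : Type*} [AddCommGroup F] [DecidableEq F] (D : Finset F) : ℕ → Finset F
  | 0 => {0}
  | k + 1 => bl D k + (D + D)

section basics
variable {F : Type*} [AddCommGroup F] [DecidableEq F] {D : Finset F}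

lemma bl_add (a b : ℕ) : bl D (a + b) = bl D a + bl D b := by
  induction b with
  | zero => rw [Nat.add_zero, bl, singleton_zero, add_zero]
  | succ b ih => rw [← Nat.add_assoc, bl, ih, bl, add_assoc]

lemma bl_one : bl D 1 = D + D := by rw [bl, bl, singleton_zero, zero_add]

lemma zero_mem_E (hs : ∀ x ∈ D, -x ∈ D) (hD : D.Nonempty) : (0 : F) ∈ D + D := by
  obtain ⟨x, hx⟩ := hD
  exact mem_add.2 ⟨x, hx, -x, hs x hx, by simp⟩

lemma zero_mem_bl (hs : ∀ x ∈ D, -x ∈ D) (hD : D.Nonempty) (k : ℕ) : (0 : F) ∈ bl D k := by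
  induction k with
  | zero => simp [bl]
  | succ k ih => exact mem_add.2 ⟨0, ih, 0, zero_mem_E hs hD, by simp⟩

lemma bl_mono (hs : ∀ x ∈ D, -x ∈ D) (hD : D.Nonempty) {a b : ℕ} (h : a ≤ b) :
    bl D a ⊆ bl D b := by
  obtain ⟨c, rfl⟩ := Nat.exists_eq_add_of_le h
  rw [bl_add]
  exact subset_add_left _ (zero_mem_bl hs hD c)

lemma neg_mem_bl (hs : ∀ x ∈ D, -x ∈ D) (k : ℕ) : ∀ x ∈ bl D k, -x ∈ bl D k := by
  induction k with
  | zero => simp [bl]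
  | succ k ih =>
    intro x hx
    rw [bl] at hx ⊢
    obtain ⟨y, hy, z, hz, rfl⟩ := mem_add.1 hx
    obtain ⟨u, hu, v, hv, rfl⟩ := mem_add.1 hz
    exact mem_add.2 ⟨-y, ih y hy, -u + -v, mem_add.2 ⟨-u, hs u hu, -v, hs v hv, rfl⟩, by abel⟩

lemma mem_bl_add {a b : ℕ} {x y : F} (hx : x ∈ bl D a) (hy : y ∈ bl D b) : x + y ∈ bl D (a + b) := by
  rw [bl_add]; exact add_mem_add hx hy

lemma mem_E {x y : F} (hx : x ∈ D) (hy : y ∈ D) : x + y ∈ bl D 1 := by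
  rw [bl_one]; exact add_mem_add hx hy

/-- membership in a thickened set -/
lemma mem_thick {P B : Finset F} {x : F} : x ∈ P + B ↔ ∃ p ∈ P, x - p ∈ B := by
  constructor
  · intro h
    obtain ⟨p, hp, b, hb, rfl⟩ := mem_add.1 h
    exact ⟨p, hp, by simpa using hb⟩
  · rintro ⟨p, hp, h⟩
    exact mem_add.2 ⟨p, hp, _, h, by abel⟩

lemma bl_sub_comm (hs : ∀ x ∈ D, -x ∈ D) {k : ℕ} {x y : F} (h : x - y ∈ bl D k) :
    y - x ∈ bl D k := by
  have := neg_mem_bl hs k _ h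
  simpa using this

lemma D_sub_comm (hs : ∀ x ∈ D, -x ∈ D) {x y : F} (h : x - y ∈ D) :
    y - x ∈ D := by
  have := hs _ h
  simpa using this

lemma card_le_card_add (hD : D.Nonempty) (P : Finset F) : #P ≤ #(P + D) :=
  card_le_card_add_right hD

/-- A maximal separated net. -/
lemma net (hs : ∀ x ∈ D, -x ∈ D) (hD : D.Nonempty) (C : Finset F) (m : ℕ) :
    ∃ T ⊆ C, (∀ x ∈ T, ∀ y ∈ T, y - x ∈ bl D (2 * m) → x = y) ∧ C ⊆ T + bl D (2 * m) := by
  classical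
  let S := C.powerset.filter (fun T => ∀ x ∈ T, ∀ y ∈ T, y - x ∈ bl D (2 * m) → x = y)
  have hS : S.Nonempty := ⟨∅, by simp [S]⟩
  obtain ⟨T, hT, hmax⟩ := S.exists_max_image card hS
  simp only [S, mem_filter, mem_powerset] at hT hmax
  refine ⟨T, hT.1, hT.2, ?_⟩
  intro c hc
  by_contra hcon
  have hne : ∀ p ∈ T, c - p ∉ bl D (2 * m) := by
    intro p hp h
    exact hcon (mem_thick.2 ⟨p, hp, h⟩)
  have hcT : c ∉ T := fun h => hne c h (by simpa using zero_mem_bl hs hD _)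
  have := hmax (insert c T) ⟨insert_subset hc hT.1, by
    intro x hx y hy hxy
    rcases mem_insert.1 hx with rfl | hx' <;> rcases mem_insert.1 hy with rfl | hy'
    · rfl
    · exact absurd (bl_sub_comm hs hxy) (hne y hy')
    · exact absurd hxy (hne x hx')
    · exact hT.2 x hx' y hy' hxy⟩
  rw [card_insert_of_notMem hcT] at this
  omega

/-- Disjoint balls around a separated set: count. -/
lemma sep_card {T X : Finset F} (hs : ∀ x ∈ D, -x ∈ D) {m : ℕ}
    (hT : ∀ x ∈ T, ∀ y ∈ T, y - x ∈ bl D (2 * m) → x = y)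
    (hX : ∀ x ∈ T, ∀ b ∈ bl D m, x + b ∈ X) : #T * #(bl D m) ≤ #X := by
  rw [← card_product]
  apply card_le_card_of_injOn (fun p => p.1 + p.2)
  · intro p hp
    have hp' := mem_product.1 (mem_coe.1 hp)
    exact hX _ hp'.1 _ hp'.2
  · intro p hp q hq h
    have hp' := mem_product.1 (mem_coe.1 hp)
    have hq' := mem_product.1 (mem_coe.1 hq)
    simp only at h
    have h1 : q.1 - p.1 = p.2 + -q.2 := by
      have : q.1 = p.1 + p.2 - q.2 := by rw [h]; abel
      rw [this]; abel
    have h2 : p.1 = q.1 := by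
      apply hT _ hp'.1 _ hq'.1
      rw [h1, two_mul]
      exact mem_bl_add hp'.2 (neg_mem_bl hs m _ hq'.2)
    have h3 : p.2 = q.2 := by rw [h2] at h; exact add_left_cancel h
    exact Prod.ext h2 h3

end basics

section iso
variable {F : Type*} [AddCommGroup F] [Fintype F] [DecidableEq F] {D : Finset F}

/-- The subgroup generated by `D + D`. -/
def HH (D : Finset F) : AddSubgroup F := AddSubgroup.closure ((D + D : Finset F) : Set F)

/-- its order -/
noncomputable def hh (D : Finset F) : ℕ := Nat.card (HH D)

lemma bl_sub_HH (k : ℕ) : ∀ x ∈ bl D k, x ∈ HH D := by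
  induction k with
  | zero => intro x hx; simp [bl] at hx; subst hx; exact zero_mem _
  | succ k ih =>
    intro x hx
    rw [bl] at hx
    obtain ⟨y, hy, z, hz, rfl⟩ := mem_add.1 hx
    exact add_mem (ih y hy) (AddSubgroup.subset_closure (by exact_mod_cast hz))

lemma coset_card_le (P : Finset F) (x : F) (hP : ∀ p ∈ P, p - x ∈ HH D) : #P ≤ hh D := by
  classical
  have : #P = Nat.card P := by simp
  rw [this, hh]
  apply Nat.card_le_card_of_injective (fun p : P => (⟨p.1 - x, hP p.1 p.2⟩ : HH D))
  intro p q h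
  simp only [Subtype.mk.injEq, sub_left_inj] at h
  exact Subtype.ext h

lemma D_diff (hs : ∀ x ∈ D, -x ∈ D) {x y : F} (hx : x ∈ D) (hy : y ∈ D) : x - y ∈ HH D := by
  apply AddSubgroup.subset_closure
  rw [sub_eq_add_neg]
  exact_mod_cast add_mem_add hx (hs y hy)

/-- the coset `x + H` as a finset -/
noncomputable def cosetF (D : Finset F) (x : F) : Finset F := by
  classical exact univ.filter (fun y => y - x ∈ HH D)

lemma mem_cosetF {x y : F} : y ∈ cosetF D x ↔ y - x ∈ HH D := by simp [cosetF]

lemma card_cosetF (x : F) : #(cosetF D x) = hh D := by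
  classical
  have : #(cosetF D x) = Nat.card (cosetF D x) := by simp
  rw [this, hh]
  apply Nat.card_congr
  exact { toFun := fun p => ⟨p.1 - x, mem_cosetF.1 p.2⟩
          invFun := fun k => ⟨k.1 + x, mem_cosetF.2 (by simp)⟩
          left_inv := fun p => by simp
          right_inv := fun k => by simp }

/-- Hamidoune's atom argument. -/
lemma iso_coset (hs : ∀ x ∈ D, -x ∈ D) (hD : D.Nonempty) (P : Finset F) (x : F)
    (hPne : P.Nonempty) (hP : ∀ p ∈ P, p - x ∈ HH D) (hfull : #(P + D) < hh D) :
    2 * #P + #D ≤ 2 * #(P + D) := by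
  classical
  obtain ⟨e, he⟩ := hD
  have hD : D.Nonempty := ⟨e, he⟩
  have hee : e + e ∈ HH D := by
    apply AddSubgroup.subset_closure; exact_mod_cast add_mem_add he he
  let N := Fintype.card F
  -- admissible sets
  let S : Finset (Finset F) := univ.filter (fun P => P.Nonempty ∧
    (∀ p ∈ P, ∀ q ∈ P, p - q ∈ HH D) ∧ #(P + D) < hh D)
  have hPS : P ∈ S := by
    simp only [S, mem_filter, mem_univ, true_and]
    refine ⟨hPne, ?_, hfull⟩
    intro p hp q hq
    have := sub_mem (hP p hp) (hP q hq)
    simpa using this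
  have hcd : ∀ Q : Finset F, #Q ≤ #(Q + D) := card_le_card_add hD
  have hcN : ∀ Q : Finset F, #Q ≤ N := fun Q => card_le_univ Q
  obtain ⟨Q, hQ, hmin⟩ := S.exists_min_image (fun Q => (#(Q + D) - #Q) * (N + 1) + #Q) ⟨P, hPS⟩
  -- lexicographic consequences
  have hmin1 : ∀ R ∈ S, #(Q + D) - #Q ≤ #(R + D) - #R := by
    intro R hR
    have := hmin R hR
    have h2 := hcN R
    by_contra hlt
    push Not at hlt
    have : (#(R + D) - #R + 1) * (N + 1) ≤ (#(Q + D) - #Q) * (N + 1) := Nat.mul_le_mul_right _ hlt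
    nlinarith
  have hmin2 : ∀ R ∈ S, #(R + D) - #R ≤ #(Q + D) - #Q → #Q ≤ #R := by
    intro R hR h
    have h1 := hmin R hR
    have h2 : #(R + D) - #R = #(Q + D) - #Q := le_antisymm h (hmin1 R hR)
    simp only [h2] at h1
    omega
  have hQ' := hQ
  simp only [S, mem_filter, mem_univ, true_and] at hQ'
  obtain ⟨⟨q0, hq0⟩, hQc, hQf⟩ := hQ'
  -- the dual set
  let R := (cosetF D (q0 + e)) \ (Q + D)
  have hQDsub : Q + D ⊆ cosetF D (q0 + e) := by
    intro y hy
    obtain ⟨q, hq, δ, hδ, rfl⟩ := mem_add.1 hy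
    rw [mem_cosetF]
    have := add_mem (hQc q hq q0 hq0) (D_diff hs hδ he)
    convert this using 1; abel
  have hRcard : #R + #(Q + D) = hh D := by
    rw [card_sdiff_add_card_eq_card hQDsub, card_cosetF]
  have hRD : #(R + D) + #Q ≤ hh D := by
    rw [← card_cosetF q0, ← card_union_of_disjoint]
    · apply card_le_card
      intro y hy
      rw [mem_cosetF]
      rcases mem_union.1 hy with hy | hy
      · obtain ⟨r, hr, δ, hδ, rfl⟩ := mem_add.1 hy
        have h1 := mem_cosetF.1 (mem_sdiff.1 hr).1
        have := add_mem (add_mem h1 (D_diff hs hδ he)) hee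
        convert this using 1; abel
      · exact hQc y hy q0 hq0
    · rw [disjoint_left]
      intro y hy hyQ
      obtain ⟨r, hr, δ, hδ, rfl⟩ := mem_add.1 hy
      apply (mem_sdiff.1 hr).2
      exact mem_add.2 ⟨r + δ, hyQ, -δ, hs δ hδ, by abel⟩
  have hQpos : 0 < #Q := card_pos.2 ⟨q0, hq0⟩
  have hRS : R ∈ S := by
    simp only [S, mem_filter, mem_univ, true_and]
    refine ⟨card_pos.1 (by omega), ?_, by omega⟩
    intro p hp q hq
    have h1 := mem_cosetF.1 (mem_sdiff.1 hp).1
    have h2 := mem_cosetF.1 (mem_sdiff.1 hq).1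
    have := sub_mem h1 h2
    simpa using this
  have hQR : #Q ≤ #R := by
    apply hmin2 R hRS
    have := hcd R
    have := hcd Q
    omega
  -- translates of Q meeting Q are equal to Q
  have htr : ∀ g : F, (∃ y ∈ Q, y + g ∈ Q) → ∀ y ∈ Q, y + g ∈ Q := by
    rintro g ⟨y0, hy0, hy0'⟩
    by_contra hcon
    push Not at hcon
    obtain ⟨y1, hy1, hy1'⟩ := hcon
    let Q2 : Finset F := Q + {g}
    have hQ2c : #Q2 = #Q := by simp [Q2]
    have hQ2D : #(Q2 + D) = #(Q + D) := by
      have : Q2 + D = (Q + D) + {g} := by simp only [Q2]; rw [add_right_comm]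
      rw [this]; simp
    have hg : g ∈ HH D := by
      have := hQc _ hy0' _ hy0
      simpa using this
    have hQ2c0 : ∀ q ∈ Q2, q - q0 ∈ HH D := by
      intro q hq
      obtain ⟨y, hy, z, hz, rfl⟩ := mem_add.1 hq
      rw [mem_singleton] at hz; subst hz
      have := add_mem (hQc y hy q0 hq0) hg
      convert this using 1; abel
    have hIne : (Q ∩ Q2).Nonempty := ⟨y0 + g, mem_inter.2 ⟨hy0', add_mem_add hy0 (by simp)⟩⟩
    have hIlt : #(Q ∩ Q2) < #Q := by
      rw [← hQ2c]
      apply card_lt_card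
      refine ⟨inter_subset_right, fun h => hy1' ?_⟩
      exact (mem_inter.1 (h (add_mem_add hy1 (by simp : g ∈ ({g} : Finset F))))).1
    have hIS : Q ∩ Q2 ∈ S := by
      simp only [S, mem_filter, mem_univ, true_and]
      refine ⟨hIne, fun p hp q hq => hQc p (mem_inter.1 hp).1 q (mem_inter.1 hq).1, ?_⟩
      exact lt_of_le_of_lt (card_le_card (add_subset_add_right inter_subset_left)) hQf
    have hI : #(Q + D) - #Q < #((Q ∩ Q2) + D) - #(Q ∩ Q2) := by
      by_contra h
      push Not at h
      have := hmin2 _ hIS h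
      omega
    have hsub : #((Q ∪ Q2) + D) + #((Q ∩ Q2) + D) ≤ #(Q + D) + #(Q2 + D) := by
      rw [← card_union_add_card_inter (Q + D), union_add]
      exact Nat.add_le_add_left (card_le_card (inter_add_subset)) _
    have hcards := card_union_add_card_inter Q Q2
    have hcU := hcd (Q ∪ Q2)
    have hcI := hcd (Q ∩ Q2)
    have hcQ := hcd Q
    -- union is not admissible
    by_cases hU : #((Q ∪ Q2) + D) < hh D
    · have hUS : Q ∪ Q2 ∈ S := by
        simp only [S, mem_filter, mem_univ, true_and]
        refine ⟨⟨q0, mem_union_left _ hq0⟩, ?_, hU⟩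
        have hall : ∀ p ∈ Q ∪ Q2, p - q0 ∈ HH D := by
          intro p hp
          rcases mem_union.1 hp with hp | hp
          · exact hQc p hp q0 hq0
          · exact hQ2c0 p hp
        intro p hp q hq
        have := sub_mem (hall p hp) (hall q hq)
        simpa using this
      have := hmin1 _ hUS
      omega
    · have : 0 < #(Q ∩ Q2) := card_pos.2 hIne
      omega
  -- two elements of D in different cosets of the stabilizer
  let K : AddSubgroup F :=
    { carrier := {g | ∀ y ∈ Q, y + g ∈ Q}
      zero_mem' := by intro y hy; simpa using hy
      add_mem' := by
        intro a b ha hb y hy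
        rw [← add_assoc]; exact hb _ (ha y hy)
      neg_mem' := by
        intro a ha
        exact htr (-a) ⟨q0 + a, ha q0 hq0, by simpa using hq0⟩ }
  have hex : ∃ a ∈ D, ∃ b ∈ D, a - b ∉ K := by
    by_contra hcon
    push Not at hcon
    have hHK : HH D ≤ K := by
      rw [HH, AddSubgroup.closure_le]
      intro z hz
      obtain ⟨a, ha, b, hb, rfl⟩ := mem_add.1 (by exact_mod_cast hz : z ∈ D + D)
      have := hcon a ha (-b) (hs b hb)
      simpa using this
    have : hh D ≤ #Q := by
      rw [← card_cosetF q0]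
      apply card_le_card
      intro y hy
      have := hHK (mem_cosetF.1 hy) q0 hq0
      simpa using this
    have := hcd Q
    omega
  obtain ⟨a, ha, b, hb, hab⟩ := hex
  have h2Q : 2 * #Q ≤ #(Q + D) := by
    have hdis : Disjoint (Q + {a}) (Q + {b}) := by
      rw [disjoint_left]
      intro y hy hy'
      obtain ⟨u, hu, z, hz, rfl⟩ := mem_add.1 hy
      obtain ⟨v, hv, w, hw, hvw⟩ := mem_add.1 hy'
      rw [mem_singleton] at hz hw
      subst hz; subst hw
      apply hab
      apply htr
      refine ⟨u, hu, ?_⟩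
      have : u + (z - w) = v := by rw [← add_sub_assoc, ← hvw]; abel
      rw [this]; exact hv
    have : #((Q + {a}) ∪ (Q + {b})) = 2 * #Q := by
      rw [card_union_of_disjoint hdis]; simp; omega
    rw [← this]
    apply card_le_card
    apply union_subset <;> apply add_subset_add_left <;> simpa
  have hdQ : #D ≤ #(Q + D) := card_le_card_add_left ⟨q0, hq0⟩
  have h3 := hmin1 P hPS
  have := hcd P
  have := hcd Q
  omega

/-- General isoperimetry: either a full coset or expansion. -/
lemma iso_gen (hs : ∀ x ∈ D, -x ∈ D) (hD : D.Nonempty) (P : Finset F) 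
    (hPne : P.Nonempty) (hfull : ∀ x, ¬ cosetF D x ⊆ P + D) :
    2 * #P + #D ≤ 2 * #(P + D) := by
  classical
  obtain ⟨x, hx⟩ := hPne
  obtain ⟨e, he⟩ := hD
  have hD : D.Nonempty := ⟨e, he⟩
  let P1 := P.filter (fun p => p - x ∈ HH D)
  let P2 := P.filter (fun p => ¬ (p - x ∈ HH D))
  have hc : #P1 + #P2 = #P := card_filter_add_card_filter_not (s := P) _
  have hdis : Disjoint (P1 + D) (P2 + D) := by
    rw [disjoint_left]
    intro y hy hy'
    obtain ⟨u, hu, a, ha, rfl⟩ := mem_add.1 hy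
    obtain ⟨v, hv, b, hb, hvb⟩ := mem_add.1 hy'
    have hu' := (mem_filter.1 hu).2
    have hv' := (mem_filter.1 hv).2
    apply hv'
    have : v - x = (u - x) + (a - b) := by
      have : v = u + a - b := by rw [← hvb]; abel
      rw [this]; abel
    rw [this]
    exact add_mem hu' (D_diff hs ha hb)
  have hle : #(P1 + D) + #(P2 + D) ≤ #(P + D) := by
    rw [← card_union_of_disjoint hdis]
    apply card_le_card
    apply union_subset <;> exact add_subset_add_right (filter_subset _ _)
  have h2 := card_le_card_add hD P2
  have hsub : P1 + D ⊆ cosetF D (x + e) := by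
    intro y hy
    obtain ⟨u, hu, a, ha, rfl⟩ := mem_add.1 hy
    rw [mem_cosetF]
    have := add_mem (mem_filter.1 hu).2 (D_diff hs ha he)
    convert this using 1; abel
  have hlt : #(P1 + D) < hh D := by
    by_contra h
    push Not at h
    have : P1 + D = cosetF D (x + e) := eq_of_subset_of_card_le hsub (by rw [card_cosetF]; exact h)
    apply hfull (x + e)
    rw [← this]
    exact add_subset_add_right (filter_subset _ _)
  have := iso_coset hs hD P1 x ⟨x, mem_filter.2 ⟨hx, by simp⟩⟩ (fun p hp => (mem_filter.1 hp).2) hlt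
  omega

lemma bl_grow (hs : ∀ x ∈ D, -x ∈ D) (hD : D.Nonempty) (m : ℕ) :
    hh D ≤ #(bl D m) ∨ m * #D + 2 ≤ 2 * #(bl D m) := by
  induction m with
  | zero => right; simp [bl]
  | succ m ih =>
    have hmono : #(bl D m) ≤ #(bl D (m + 1)) := card_le_card (bl_mono hs hD (Nat.le_succ m))
    have h1 : #(bl D m + D) ≤ #(bl D (m + 1)) := by
      rw [bl, ← add_assoc]; exact card_le_card_add hD _
    rcases ih with h | h
    · left; omega
    · by_cases hf : #(bl D m + D) < hh D
      · right
        have := iso_coset hs hD (bl D m) 0 ⟨0, zero_mem_bl hs hD m⟩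
          (fun p hp => by simpa using bl_sub_HH m p hp) hf
        have h3 : (m + 1) * #D = m * #D + #D := by ring
        omega
      · left; omega

end iso
end ACG

namespace ACG
set_option linter.unusedSectionVars false
open Finset

section chain
variable {F : Type*} [AddCommGroup F] [Fintype F] [DecidableEq F] {D : Finset F}

/-- the expansion defect `|P + D| - |P|` -/
def tt (D P : Finset F) : ℕ := #(P + D) - #P

lemma tt_add (hD : D.Nonempty) (P : Finset F) : #P + tt D P = #(P + D) := by
  have := card_le_card_add hD P
  unfold tt; omega

/-- `A'` minimises `r t(B) - |B|` over subsets `B` of `A`. -/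
def Mn (D : Finset F) (r : ℕ) (A' A : Finset F) : Prop :=
  A' ⊆ A ∧ ∀ B ⊆ A, r * tt D A' + #B ≤ r * tt D B + #A'

lemma Mn_exists (D : Finset F) (r : ℕ) (A : Finset F) : ∃ A', Mn D r A' A := by
  obtain ⟨A', h, h'⟩ := A.powerset.exists_min_image
    (fun B => ((r : ℤ) * tt D B - #B)) ⟨∅, by simp⟩
  refine ⟨A', mem_powerset.1 h, fun B hB => ?_⟩
  have := h' B (mem_powerset.2 hB)
  zify; linarith

lemma petridis (hD : D.Nonempty) {r : ℕ} {A' : Finset F}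
    (h : ∀ B ⊆ A', r * tt D A' + #B ≤ r * tt D B + #A') (S : Finset F) (hS : S.Nonempty) :
    r * #(A' + D + S) + (r + 1) * #A' ≤ (r + 1) * #(A' + S) + r * #(A' + D) := by
  induction hS using Finset.Nonempty.cons_induction with
  | singleton s =>
    simp only [card_add_singleton]; omega
  | cons s S hs hS ih =>
    rw [cons_eq_insert]
    let B := A'.filter (fun x => x + s ∈ A' + S)
    have hB : B ⊆ A' := filter_subset _ _
    have e1 : #(A' + insert s S) + #B = #(A' + S) + #A' := by
      have h1 : A' + insert s S = (A' + S) ∪ (A' + {s}) := by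
        rw [insert_eq, add_union, union_comm]
      have h2 : #((A' + S) ∩ (A' + {s})) = #B := by
        have : (A' + S) ∩ (A' + {s}) = B + {s} := by
          ext y
          rw [mem_inter, mem_add (s := A') (t := {s}), mem_add (s := B)]
          constructor
          · rintro ⟨hy, a, ha, z, hz, rfl⟩
            rw [mem_singleton] at hz; subst hz
            exact ⟨a, mem_filter.2 ⟨ha, hy⟩, z, by simp, rfl⟩
          · rintro ⟨a, ha, z, hz, rfl⟩
            rw [mem_singleton] at hz; subst hz
            exact ⟨(mem_filter.1 ha).2, a, (mem_filter.1 ha).1, z, by simp, rfl⟩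
        rw [this]; simp
      rw [h1, ← h2, card_union_add_card_inter]; simp
    have e2 : #(A' + D + insert s S) + #(B + D) ≤ #(A' + D + S) + #(A' + D) := by
      have hsub : A' + D + insert s S ⊆ (A' + D + S) ∪ ((A' + D + {s}) \ (B + D + {s})) := by
        intro y hy
        rw [insert_eq, add_union] at hy
        by_cases hy2 : y ∈ A' + D + S
        · exact mem_union_left _ hy2
        rcases mem_union.1 hy with hy | hy
        · refine mem_union_right _ (mem_sdiff.2 ⟨hy, fun hy' => hy2 ?_⟩)
          rw [add_right_comm] at hy' ⊢
          obtain ⟨u, hu, δ, hδ, rfl⟩ := mem_add.1 hy'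
          refine add_mem_add ?_ hδ
          obtain ⟨b, hb, z, hz, rfl⟩ := mem_add.1 hu
          rw [mem_singleton] at hz; subst hz
          exact (mem_filter.1 hb).2
        · exact absurd hy hy2
      have h1 := card_le_card hsub
      have h2 := card_union_le (A' + D + S) ((A' + D + {s}) \ (B + D + {s}))
      have h3 : #((A' + D + {s}) \ (B + D + {s})) + #(B + D + {s}) = #(A' + D + {s}) :=
        card_sdiff_add_card_eq_card (add_subset_add_right (add_subset_add_right hB))
      rw [card_add_singleton, card_add_singleton] at h3
      omega
    have h3 := h B hB
    have h4 := tt_add hD B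
    have h5 := tt_add hD A'
    zify at *
    nlinarith

/-- the absolute constant -/
def kap : ℕ := 3 ^ 42

lemma pet_growth (hD : D.Nonempty) (hs : ∀ x ∈ D, -x ∈ D) {r : ℕ} (hr : 0 < r) {A' : Finset F}
    (h : ∀ B ⊆ A', r * tt D A' + #B ≤ r * tt D B + #A') (k : ℕ) (hk : k ≤ 21 * r) :
    #(A' + bl D k) ≤ #A' + kap * r * tt D A' := by
  have hr' : (0 : ℝ) < r := by exact_mod_cast hr
  have key : ∀ k : ℕ, ((#(A' + bl D k) : ℝ) - #A' + r * tt D A') ≤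
      r * tt D A' * ((1 + 1 / r) ^ 2) ^ k := by
    intro k
    induction k with
    | zero => simp [bl]
    | succ k ih =>
      have h1 := petridis hD h (bl D k) ⟨0, zero_mem_bl hs hD k⟩
      have h2 := petridis hD h (D + bl D k) (hD.add ⟨0, zero_mem_bl hs hD k⟩)
      have e1 : A' + D + bl D k = A' + (D + bl D k) := add_assoc _ _ _
      have e2 : A' + D + (D + bl D k) = A' + bl D (k + 1) := by
        rw [bl, add_comm (bl D k), add_assoc, add_assoc D]
      rw [e1] at h1
      rw [e2] at h2
      have h5 := tt_add hD A'
      have h1' : (r : ℝ) * #(A' + (D + bl D k)) + (r + 1) * #A' ≤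
        (r + 1) * #(A' + bl D k) + r * #(A' + D) := by exact_mod_cast h1
      have h2' : (r : ℝ) * #(A' + bl D (k + 1)) + (r + 1) * #A' ≤
        (r + 1) * #(A' + (D + bl D k)) + r * #(A' + D) := by exact_mod_cast h2
      have h5' : (#A' : ℝ) + tt D A' = #(A' + D) := by exact_mod_cast h5
      rw [← h5'] at h1' h2'
      have a1 : ((#(A' + (D + bl D k)) : ℝ) - #A' + r * tt D A') ≤
          (1 + 1 / r) * ((#(A' + bl D k) : ℝ) - #A' + r * tt D A') := by
        have : (1 + 1 / (r : ℝ)) = (r + 1) / r := by field_simp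
        rw [this, div_mul_eq_mul_div, le_div_iff₀ hr']
        nlinarith
      have a2 : ((#(A' + bl D (k + 1)) : ℝ) - #A' + r * tt D A') ≤
          (1 + 1 / r) * ((#(A' + (D + bl D k)) : ℝ) - #A' + r * tt D A') := by
        have : (1 + 1 / (r : ℝ)) = (r + 1) / r := by field_simp
        rw [this, div_mul_eq_mul_div, le_div_iff₀ hr']
        nlinarith
      have hp : 0 ≤ (1 + 1 / (r : ℝ)) := by positivity
      calc _ ≤ (1 + 1 / (r : ℝ)) * ((1 + 1 / r) * ((#(A' + bl D k) : ℝ) - #A' + r * tt D A')) :=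
            a2.trans (mul_le_mul_of_nonneg_left a1 hp)
        _ ≤ (1 + 1 / (r : ℝ)) * ((1 + 1 / r) * (r * tt D A' * ((1 + 1 / r) ^ 2) ^ k)) := by gcongr
        _ = _ := by ring
  have hk1 := key k
  have hb : ((1 + 1 / (r : ℝ)) ^ 2) ^ k ≤ kap := by
    have h1 : (1 + 1 / (r : ℝ)) ≤ Real.exp (1 / r) := by
      have := Real.add_one_le_exp (1 / (r : ℝ)); linarith
    calc ((1 + 1 / (r : ℝ)) ^ 2) ^ k ≤ ((Real.exp (1 / r)) ^ 2) ^ k := by gcongr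
      _ = Real.exp ((2 * k : ℕ) * (1 / r)) := by rw [← pow_mul, Real.exp_nat_mul]
      _ ≤ Real.exp ((42 : ℕ) * 1) := by
          apply Real.exp_le_exp.2
          rw [mul_one_div, div_le_iff₀ hr']
          have : (k : ℝ) ≤ 21 * r := by exact_mod_cast hk
          push_cast; linarith
      _ = Real.exp 1 ^ 42 := by rw [Real.exp_nat_mul]
      _ ≤ 3 ^ 42 := by
          apply pow_le_pow_left₀ (Real.exp_pos _).le
          have := Real.exp_one_lt_d9; linarith
      _ = (kap : ℝ) := by rw [kap]; norm_num
  have h0 : (0 : ℝ) ≤ r * tt D A' := by positivity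
  have : (#(A' + bl D k) : ℝ) ≤ #A' + kap * r * tt D A' := by nlinarith
  exact_mod_cast this

/-- the fresh-centres bound -/
lemma fresh (hs : ∀ x ∈ D, -x ∈ D) (hD : D.Nonempty) {r : ℕ} (hr : 2 ≤ r) {A' A T : Finset F}
    (hM : Mn D r A' A) (hTA : T ⊆ A)
    (hT : ∀ x ∈ T, ∀ y ∈ T, y - x ∈ bl D (2 * r) → x = y)
    (hC : ∀ x ∈ T, ∀ a ∈ A', a - x ∉ bl D r) (hfull : #(bl D r) < hh D) :
    #T * #D + 8 * tt D A' ≤ 8 * tt D A := by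
  obtain ⟨ρ, rfl⟩ : ∃ ρ, r = ρ + 1 := ⟨r - 1, by omega⟩
  have hρ : 1 ≤ ρ := by omega
  let f : F → ℕ → ℕ := fun x i => #((A + D).filter (fun y => y - x ∈ D + bl D i))
  have hfm : ∀ x i, f x i ≤ f x (i + 1) := by
    intro x i
    apply card_le_card
    intro y hy
    rw [mem_filter] at hy ⊢
    exact ⟨hy.1, add_subset_add_left (bl_mono hs hD (Nat.le_succ i)) hy.2⟩
  have hpick : ∀ x, ∃ i < ρ, ρ * (f x (i + 1) - f x i) ≤ f x ρ := by
    intro x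
    by_contra hcon
    push Not at hcon
    have h1 : ∑ i ∈ range ρ, (f x (i + 1) - f x i) = f x ρ - f x 0 :=
      Finset.sum_range_tsub (monotone_nat_of_le_succ (hfm x)) ρ
    have h2 : ∑ i ∈ range ρ, f x ρ < ∑ i ∈ range ρ, ρ * (f x (i + 1) - f x i) := by
      apply sum_lt_sum_of_nonempty ⟨0, by simp; omega⟩
      intro i hi; exact hcon i (mem_range.1 hi)
    rw [← mul_sum, h1] at h2
    simp only [sum_const, card_range, smul_eq_mul] at h2
    have := Nat.lt_of_mul_lt_mul_left h2
    omega
  choose i hi hif using hpick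
  -- the pieces
  let P : F → Finset F := fun x => A.filter (fun y => y - x ∈ bl D (i x + 1))
  let R := A \ T.biUnion P
  have hPD : ∀ x, ∀ y ∈ P x + D, y - x ∈ D + bl D (i x + 1) := by
    intro x y hy
    obtain ⟨u, hu, δ, hδ, rfl⟩ := mem_add.1 hy
    have := (mem_filter.1 hu).2
    exact mem_add.2 ⟨δ, hδ, _, this, by abel⟩
  have hmonoρ : ∀ x, D + bl D (i x + 1) ⊆ D + bl D ρ := fun x =>
    add_subset_add_left (bl_mono hs hD (hi x))
  have hsepV : ∀ x ∈ T, ∀ x' ∈ T, ∀ y, y - x ∈ D + bl D ρ → y - x' ∈ D + bl D ρ → x = x' := by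
    intro x hx x' hx' y h1 h2
    obtain ⟨δ, hδ, b, hb, e⟩ := mem_add.1 h1
    obtain ⟨δ', hδ', b', hb', e'⟩ := mem_add.1 h2
    apply hT x hx x' hx'
    have e3 : x' - x = (δ + -δ') + (b + -b') := by
      have : x' - x = (y - x) - (y - x') := by abel
      rw [this, ← e, ← e']; abel
    rw [e3]
    have := mem_bl_add (mem_E hδ (hs _ hδ')) (mem_bl_add hb (neg_mem_bl hs _ _ hb'))
    exact bl_mono hs hD (by omega) this
  have hVA' : ∀ x ∈ T, ∀ y ∈ A' + D, y - x ∉ D + bl D ρ := by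
    intro x hx y hy h
    obtain ⟨a, ha, δ, hδ, rfl⟩ := mem_add.1 hy
    obtain ⟨δ', hδ', b, hb, e⟩ := mem_add.1 h
    apply hC x hx a ha
    have : a - x = b + (δ' + -δ) := by
      have : a - x = (a + δ - x) - δ := by abel
      rw [this, ← e]; abel
    rw [this]
    exact mem_bl_add hb (mem_E hδ' (hs _ hδ))
  -- sum of the regions
  have hsumV : ∑ x ∈ T, f x ρ + #(A' + D) ≤ #(A + D) := by
    have hb : ∑ x ∈ T, f x ρ =
        #(T.biUnion (fun x => (A + D).filter (fun y => y - x ∈ D + bl D ρ))) := by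
      rw [card_biUnion]
      intro x hx x' hx' hne
      rw [Function.onFun, disjoint_left]
      intro y hy hy'
      exact hne (hsepV x hx x' hx' y (mem_filter.1 hy).2 (mem_filter.1 hy').2)
    rw [hb, ← card_union_of_disjoint]
    · apply card_le_card
      apply union_subset
      · apply biUnion_subset.2; intro x _; exact filter_subset _ _
      · exact add_subset_add_right hM.1
    · rw [disjoint_left]
      intro y hy hy'
      obtain ⟨x, hx, hy⟩ := mem_biUnion.1 hy
      exact hVA' x hx y hy' (mem_filter.1 hy).2
  have hPdisj : ∀ x ∈ T, ∀ x' ∈ T, x ≠ x' → Disjoint (P x + D) (P x' + D) := by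
    intro x hx x' hx' hne
    rw [disjoint_left]
    intro y hy hy'
    exact hne (hsepV x hx x' hx' y (hmonoρ x (hPD x y hy)) (hmonoρ x' (hPD x' y hy')))
  obtain ⟨e0, he0⟩ := id hD
  have hPdisj0 : ∀ x ∈ T, ∀ x' ∈ T, x ≠ x' → Disjoint (P x) (P x') := by
    intro x hx x' hx' hne
    rw [disjoint_left]
    intro y hy hy'
    exact disjoint_left.1 (hPdisj x hx x' hx' hne) (add_mem_add hy he0) (add_mem_add hy' he0)
  have hcA : #R + ∑ x ∈ T, #(P x) = #A := by
    rw [← card_biUnion hPdisj0]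
    apply card_sdiff_add_card_eq_card
    apply biUnion_subset.2; intro x _; exact filter_subset _ _
  have hov : ∀ x ∈ T, #((P x + D) ∩ (R + D)) + f x (i x) ≤ f x (i x + 1) := by
    intro x hx
    rw [← card_union_of_disjoint]
    · apply card_le_card
      apply union_subset
      · intro y hy
        have h1 := (mem_inter.1 hy).1
        exact mem_filter.2 ⟨add_subset_add_right (filter_subset _ _) h1, hPD x y h1⟩
      · intro y hy
        rw [mem_filter] at hy ⊢
        exact ⟨hy.1, add_subset_add_left (bl_mono hs hD (Nat.le_succ _)) hy.2⟩
    · rw [disjoint_left]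
      intro y hy hy'
      obtain ⟨q, hq, δ, hδ, rfl⟩ := mem_add.1 (mem_inter.1 hy).2
      obtain ⟨δ', hδ', b, hb, e⟩ := mem_add.1 (mem_filter.1 hy').2
      apply (mem_sdiff.1 hq).2
      refine mem_biUnion.2 ⟨x, hx, mem_filter.2 ⟨(mem_sdiff.1 hq).1, ?_⟩⟩
      have : q - x = b + (δ' + -δ) := by
        have : q - x = (q + δ - x) - δ := by abel
        rw [this, ← e]; abel
      rw [this]
      exact mem_bl_add hb (mem_E hδ' (hs _ hδ))
  have hcAD : #(R + D) + ∑ x ∈ T, #(P x + D) ≤ #(A + D) + ∑ x ∈ T, #((P x + D) ∩ (R + D)) := by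
    have h1 : ∑ x ∈ T, #(P x + D) = #(T.biUnion (fun x => P x + D)) := by
      rw [card_biUnion hPdisj]
    have h2 : #((R + D) ∩ T.biUnion (fun x => P x + D)) ≤ ∑ x ∈ T, #((P x + D) ∩ (R + D)) := by
      rw [inter_comm, biUnion_inter]
      exact card_biUnion_le
    have h3 := card_union_add_card_inter (R + D) (T.biUnion (fun x => P x + D))
    have h4 : #((R + D) ∪ T.biUnion (fun x => P x + D)) ≤ #(A + D) := by
      apply card_le_card
      apply union_subset
      · exact add_subset_add_right sdiff_subset
      · apply biUnion_subset.2; intro x _; exact add_subset_add_right (filter_subset _ _)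
    omega
  have hiso : ∀ x ∈ T, 2 * #(P x) + #D ≤ 2 * #(P x + D) := by
    intro x hx
    apply iso_coset hs hD (P x) x ⟨x, mem_filter.2 ⟨hTA hx, by simpa using zero_mem_bl hs hD _⟩⟩
    · intro p hp; exact bl_sub_HH _ _ (mem_filter.1 hp).2
    · have h1 : #(P x + D) ≤ #(D + bl D (i x + 1)) := by
        apply card_le_card_of_injOn (fun y => y - x)
        · intro y hy; exact hPD x y hy
        · intro a _ b _ h; simpa using h
      have h2 : #(D + bl D (i x + 1)) ≤ #(bl D (ρ + 1)) := by
        have : #(D + bl D (i x + 1)) ≤ #(bl D (i x + 1 + 1)) := by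
          rw [show bl D (i x + 1 + 1) = D + bl D (i x + 1) + D by
            rw [bl]; abel]
          exact card_le_card_add hD _
        exact this.trans (card_le_card (bl_mono hs hD (by have := hi x; omega)))
      omega
  have hRt : tt D A' ≤ tt D R := by
    have hRA' : A' ⊆ R := by
      intro a ha
      refine mem_sdiff.2 ⟨hM.1 ha, fun h => ?_⟩
      obtain ⟨x, hx, hax⟩ := mem_biUnion.1 h
      exact hC x hx a ha (bl_mono hs hD (by have := hi x; omega) (mem_filter.1 hax).2)
    have h1 := hM.2 R sdiff_subset
    have h2 := card_le_card hRA'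
    have h3 : (ρ + 1) * tt D A' ≤ (ρ + 1) * tt D R := by omega
    exact Nat.le_of_mul_le_mul_left h3 (by omega)
  -- conclude
  have hMA := hM.2 A (le_refl _)
  have tA := tt_add hD A
  have tA' := tt_add hD A'
  have tR := tt_add hD R
  have s1 : ρ * ∑ x ∈ T, #((P x + D) ∩ (R + D)) ≤ ∑ x ∈ T, f x ρ := by
    rw [mul_sum]
    apply sum_le_sum
    intro x hx
    refine le_trans (Nat.mul_le_mul_left _ ?_) (hif x)
    have := hov x hx; omega
  have s2 : 2 * ∑ x ∈ T, #(P x) + #T * #D ≤ 2 * ∑ x ∈ T, #(P x + D) := by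
    rw [mul_sum, mul_sum, ← smul_eq_mul (#T), ← sum_const, ← sum_add_distrib]
    exact sum_le_sum hiso
  set ov := ∑ x ∈ T, #((P x + D) ∩ (R + D))
  set V := ∑ x ∈ T, f x ρ
  have s3 : ρ * ov + (ρ + 2) * tt D A' ≤ (ρ + 2) * tt D A := by
    nlinarith
  have s4 : ov + 3 * tt D A' ≤ 3 * tt D A := by
    have hle : tt D A' ≤ tt D A := by
      exact Nat.le_of_mul_le_mul_left ((Nat.le_add_left _ _).trans s3) (by omega)
    have : ρ * (ov + 3 * tt D A') ≤ ρ * (3 * tt D A) := by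
      obtain ⟨k, hk⟩ := Nat.exists_eq_add_of_le hle
      rw [hk] at s3 ⊢
      nlinarith
    exact Nat.le_of_mul_le_mul_left this (by omega)
  omega

lemma Mn_self {r : ℕ} {A' A : Finset F} (h : Mn D r A' A) :
    ∀ B ⊆ A', r * tt D A' + #B ≤ r * tt D B + #A' := fun B hB => h.2 B (hB.trans h.1)

lemma Mn_t {r : ℕ} (hr : 0 < r) {A' A : Finset F} (h : Mn D r A' A) : tt D A' ≤ tt D A := by
  have h1 := h.2 A (le_refl _)
  have h2 := card_le_card h.1
  have h3 : r * tt D A' ≤ r * tt D A := by omega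
  exact Nat.le_of_mul_le_mul_left h3 hr

/-- Chain lemma. -/
lemma chain (hs : ∀ x ∈ D, -x ∈ D) (hD : D.Nonempty) (hN : Fintype.card F ≤ 2 * hh D) (J : ℕ)
    (hJ : hh D ≤ #(bl D (2 ^ J))) (hJ' : ∀ j < J, #(bl D (2 ^ j)) < hh D) (A : Finset F) :
    ∃ Ac T : ℕ → Finset F,
      (∀ j, Ac j ⊆ A) ∧ (∀ j, Ac (j + 1) ⊆ Ac j) ∧
      (∀ j, #A ≤ #(Ac j) + 2 ^ j * tt D A) ∧
      (∀ j k, k ≤ 21 * 2 ^ j → #(Ac j + bl D k) ≤ #(Ac j) + kap * 2 ^ j * tt D A) ∧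
      (∀ j < J, Ac j ⊆ (Ac (j + 1) + bl D (2 ^ (j + 1))) ∪ (T j + bl D (2 ^ (j + 2)))) ∧
      (Ac J ⊆ T J + bl D (2 ^ (J + 1))) ∧
      (∀ j, T j ⊆ Ac j) ∧
      #D * ∑ j ∈ range (J + 1), #(T j) ≤ 8 * tt D A + 4 * #D := by
  choose mn hmn using fun r A => Mn_exists D r A
  let Ac : ℕ → Finset F := fun j => Nat.rec (mn 1 A) (fun j X => mn (2 ^ (j + 1)) X) j
  have h0 : Mn D 1 (Ac 0) A := hmn 1 A
  have hstep : ∀ j, Mn D (2 ^ (j + 1)) (Ac (j + 1)) (Ac j) := fun j => hmn _ _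
  have hself : ∀ j, ∀ B ⊆ Ac j, 2 ^ j * tt D (Ac j) + #B ≤ 2 ^ j * tt D B + #(Ac j) := by
    intro j
    cases j with
    | zero => simpa using Mn_self h0
    | succ j => exact Mn_self (hstep j)
  have hanti : ∀ j, tt D (Ac (j + 1)) ≤ tt D (Ac j) := fun j => Mn_t (by positivity) (hstep j)
  have hsubA : ∀ j, Ac j ⊆ A := by
    intro j
    induction j with
    | zero => exact h0.1
    | succ j ih => exact (hstep j).1.trans ih
  have htA : ∀ j, tt D (Ac j) ≤ tt D A := by
    intro j
    induction j with
    | zero => exact Mn_t (by norm_num) h0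
    | succ j ih => exact (hanti j).trans ih
  have hcard : ∀ j, #A + 2 ^ j * tt D (Ac j) ≤ #(Ac j) + 2 ^ j * tt D A := by
    intro j
    induction j with
    | zero => have := h0.2 A (le_refl _); simp at this ⊢; omega
    | succ j ih =>
      have h1 := (hstep j).2 (Ac j) (le_refl _)
      have h2 := htA j
      obtain ⟨u, hu⟩ := Nat.exists_eq_add_of_le h2
      rw [hu] at ih ⊢
      rw [pow_succ] at h1 ⊢
      nlinarith [Nat.zero_le (2 ^ j * u)]
  -- nets
  let C : ℕ → Finset F := fun j =>
    if j < J then (Ac j).filter (fun x => ∀ a ∈ Ac (j + 1), a - x ∉ bl D (2 ^ (j + 1))) else Ac J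
  let m : ℕ → ℕ := fun j => if j < J then 2 ^ (j + 1) else 2 ^ J
  choose T0 hT0C hT0s hT0n using fun j => net hs hD (C j) (m j)
  let T : ℕ → Finset F := fun j => if j ≤ J then T0 j else ∅
  have hT2 : ∀ j ≤ J, J ≤ j + 1 → #(T j) ≤ 2 := by
    intro j hj hj'
    have hm : m j = 2 ^ J := by
      simp only [m]; split_ifs with h
      · congr 1; omega
      · rfl
    have h1 := sep_card (X := univ) hs (hT0s j) (fun _ _ _ _ => mem_univ _)
    rw [hm, card_univ] at h1
    have hpos : 0 < hh D := by
      rw [hh]; exact Nat.card_pos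
    simp only [T, hj, if_true]
    by_contra hcon
    push Not at hcon
    have h2 : 3 * hh D ≤ #(T0 j) * #(bl D (2 ^ J)) := Nat.mul_le_mul hcon hJ
    omega
  have hTlow : ∀ j, j + 1 < J → #(T j) * #D + 8 * tt D (Ac (j + 1)) ≤ 8 * tt D (Ac j) := by
    intro j hj
    have hjJ : j < J := by omega
    have hm : m j = 2 ^ (j + 1) := by simp [m, hjJ]
    have hC : C j = (Ac j).filter (fun x => ∀ a ∈ Ac (j + 1), a - x ∉ bl D (2 ^ (j + 1))) := by
      simp [C, hjJ]
    have hT : T j = T0 j := by simp [T, hjJ.le]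
    rw [hT]
    have hsub := hT0C j
    rw [hC] at hsub
    have hsep := hT0s j
    rw [hm] at hsep
    apply fresh hs hD (r := 2 ^ (j + 1)) _ (hstep j) (hsub.trans (filter_subset _ _)) hsep
      (fun x hx => (mem_filter.1 (hsub hx)).2) (hJ' _ hj)
    rw [pow_succ]; have := Nat.one_le_two_pow (n := j); omega
  refine ⟨Ac, T, hsubA, fun j => (hstep j).1, ?_, ?_, ?_, ?_, ?_, ?_⟩
  · intro j
    have := hcard j
    omega
  · intro j k hk
    refine (pet_growth hD hs (by positivity) (hself j) k hk).trans ?_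
    have := Nat.mul_le_mul_left (kap * 2 ^ j) (htA j)
    omega
  · intro j hj x hx
    have hm : m j = 2 ^ (j + 1) := by simp [m, hj]
    have hC : C j = (Ac j).filter (fun x => ∀ a ∈ Ac (j + 1), a - x ∉ bl D (2 ^ (j + 1))) := by
      simp [C, hj]
    have hT : T j = T0 j := by simp [T, hj.le]
    by_cases h : ∀ a ∈ Ac (j + 1), a - x ∉ bl D (2 ^ (j + 1))
    · apply mem_union_right
      have := hT0n j (by rw [hC]; exact mem_filter.2 ⟨hx, h⟩)
      rw [hm] at this
      rw [hT, pow_succ _ (j + 1), mul_comm]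
      exact this
    · push Not at h
      obtain ⟨a, ha, hax⟩ := h
      exact mem_union_left _ (mem_thick.2 ⟨a, ha, bl_sub_comm hs hax⟩)
  · have h := hT0n J
    simp only [C, m, lt_irrefl, if_false] at h
    simp only [T, le_refl, if_true]
    rw [pow_succ, mul_comm]
    exact h
  · intro j
    simp only [T]
    split_ifs with h
    · refine (hT0C j).trans ?_
      simp only [C]
      split_ifs with h'
      · exact filter_subset _ _
      · have : j = J := by omega
        rw [this]
    · simp
  · have hlow : ∀ i, i < J → #D * ∑ j ∈ range i, #(T j) + 8 * tt D (Ac i) ≤ 8 * tt D A := by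
      intro i hi
      induction i with
      | zero => simpa using htA 0
      | succ i ih =>
        have h1 := ih (by omega)
        have h2 := hTlow i hi
        rw [sum_range_succ, mul_add, mul_comm (#D) (#(T i))]
        omega
    rw [sum_range_succ, mul_add]
    have h2 := Nat.mul_le_mul_left (#D) (hT2 J le_rfl (by omega))
    rcases Nat.eq_zero_or_pos J with h | h
    · subst h; simp at h2 ⊢; omega
    · obtain ⟨i, rfl⟩ : ∃ i, J = i + 1 := ⟨J - 1, by omega⟩
      have h1 := hlow i (by omega)
      have h3 := Nat.mul_le_mul_left (#D) (hT2 i (by omega) le_rfl)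
      rw [sum_range_succ, mul_add]
      omega

end chain
end ACG

namespace ACG
set_option linter.unusedSectionVars false
open Finset

/-- number of small subsets -/
lemma card_small {α : Type*} [DecidableEq α] (X : Finset α) (m : ℕ) :
    #(X.powerset.filter (fun Q => #Q ≤ m)) ≤ (#X + 1) ^ m := by
  induction m with
  | zero =>
    rw [pow_zero, card_le_one]
    intro a ha b hb
    have h1 := (mem_filter.1 ha).2
    have h2 := (mem_filter.1 hb).2
    rw [Nat.le_zero, card_eq_zero] at h1 h2
    rw [h1, h2]
  | succ m ih =>
    have hsub : X.powerset.filter (fun Q => #Q ≤ m + 1) ⊆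
        (X.powerset.filter (fun Q => #Q ≤ m)) ∪
        X.biUnion (fun x => (X.powerset.filter (fun Q => #Q ≤ m)).image (insert x)) := by
      intro Q hQ
      obtain ⟨hQ1, hQ2⟩ := mem_filter.1 hQ
      rw [mem_powerset] at hQ1
      by_cases h : #Q ≤ m
      · exact mem_union_left _ (mem_filter.2 ⟨mem_powerset.2 hQ1, h⟩)
      · apply mem_union_right
        obtain ⟨x, hx⟩ : Q.Nonempty := card_pos.1 (by omega)
        refine mem_biUnion.2 ⟨x, hQ1 hx, mem_image.2 ⟨Q.erase x, mem_filter.2 ⟨?_, ?_⟩, ?_⟩⟩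
        · exact mem_powerset.2 ((erase_subset _ _).trans hQ1)
        · rw [card_erase_of_mem hx]; omega
        · exact insert_erase hx
    refine (card_le_card hsub).trans ((card_union_le _ _).trans ?_)
    have h2 : #(X.biUnion (fun x => (X.powerset.filter (fun Q => #Q ≤ m)).image (insert x))) ≤
        #X * #(X.powerset.filter (fun Q => #Q ≤ m)) := by
      apply card_biUnion_le_card_mul
      intro x _; exact card_image_le
    have h3 : #X * #(X.powerset.filter (fun Q => #Q ≤ m)) ≤ #X * (#X + 1) ^ m :=
      Nat.mul_le_mul_left _ ih
    calc _ ≤ (#X + 1) ^ m + #X * (#X + 1) ^ m := by omega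
      _ = _ := by ring

section coding
variable {F : Type*} [AddCommGroup F] [Fintype F] [DecidableEq F] {D : Finset F}

def Pset (D q T : Finset F) (s : ℕ) : Finset F := (q + bl D (6 * s)) ∪ (T + bl D (4 * s))

def both (D L P P' : Finset F) (s : ℕ) : Finset F :=
  L.filter (fun z => z ∈ P + bl D (2 * s) ∧ z ∈ P' + D + bl D (8 * s))

def only (D L P P' : Finset F) (s : ℕ) : Finset F :=
  L.filter (fun z => z ∈ P + bl D (2 * s) ∧ z ∉ P' + D + bl D (8 * s))

def HInv (D A B q : Finset F) (s : ℕ) : Prop :=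
  A ⊆ q + bl D (2 * s) ∧ ∀ z ∈ q, z ∈ A + bl D (2 * s) ∨ z ∉ B + D + bl D (8 * s)

lemma thick_mono (hs : ∀ x ∈ D, -x ∈ D) (hD : D.Nonempty) {P Q : Finset F} (h : P ⊆ Q) {a b : ℕ}
    (hab : a ≤ b) : P + bl D a ⊆ Q + bl D b := add_subset_add h (bl_mono hs hD hab)

lemma thick_thick {P : Finset F} {a b : ℕ} : P + bl D a + bl D b = P + bl D (a + b) := by
  rw [add_assoc, bl_add]

lemma thickD_thick {P : Finset F} {a b : ℕ} : P + bl D a + D + bl D b = P + D + bl D (a + b) := by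
  rw [bl_add, add_right_comm P, ← add_assoc]

/-- moving a ball across -/
lemma mem_thick_of (hs : ∀ x ∈ D, -x ∈ D) {P : Finset F} {y z : F} {k : ℕ}
    (hz : z ∈ P) (h : y - z ∈ bl D k) : y ∈ P + bl D k := mem_thick.2 ⟨z, hz, h⟩

lemma step_sub (hs : ∀ x ∈ D, -x ∈ D) (hD : D.Nonempty) {A1 A2 q T : Finset F} {s : ℕ}
    (hq : A2 ⊆ q + bl D (2 * (2 * s))) (h : A1 ⊆ (A2 + bl D (2 * s)) ∪ (T + bl D (4 * s))) :
    A1 ⊆ Pset D q T s := by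
  intro x hx
  rcases mem_union.1 (h hx) with h | h
  · apply mem_union_left
    have h1 := add_subset_add_right (t := bl D (2 * s)) hq h
    rw [thick_thick] at h1
    exact thick_mono hs hD (le_refl _) (by omega) h1
  · exact mem_union_right _ h

lemma step_inv (hs : ∀ x ∈ D, -x ∈ D) (hD : D.Nonempty) {A1 B1 P P' L : Finset F} {s : ℕ}
    (hL : ∀ x : F, x ∈ L + bl D (2 * s)) (hP : A1 ⊆ P) (hP' : B1 ⊆ P') :
    HInv D A1 B1 (only D L P P' s ∪ (both D L P P' s).filter (fun z => z ∈ A1 + bl D (2 * s))) s := by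
  constructor
  · intro x hx
    obtain ⟨z, hz, hxz⟩ := mem_thick.1 (hL x)
    refine mem_thick.2 ⟨z, ?_, hxz⟩
    have hzA : z ∈ A1 + bl D (2 * s) := mem_thick.2 ⟨x, hx, bl_sub_comm hs hxz⟩
    have hzP : z ∈ P + bl D (2 * s) := add_subset_add_right hP hzA
    by_cases h : z ∈ P' + D + bl D (8 * s)
    · exact mem_union_right _ (mem_filter.2 ⟨mem_filter.2 ⟨hz, hzP, h⟩, hzA⟩)
    · exact mem_union_left _ (mem_filter.2 ⟨hz, hzP, h⟩)
  · intro z hz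
    rcases mem_union.1 hz with hz | hz
    · right
      intro h
      exact (mem_filter.1 hz).2.2 (add_subset_add_right (add_subset_add_right hP') h)
    · left; exact (mem_filter.1 hz).2

lemma step_count (hs : ∀ x ∈ D, -x ∈ D) (hD : D.Nonempty) {A1 A2 B1 B2 q q' T T' L : Finset F}
    {s a b t : ℕ} (hs1 : 1 ≤ s)
    (hL : ∀ x ∈ L, ∀ y ∈ L, y - x ∈ bl D (2 * s) → x = y)
    (hA : A2 ⊆ A1) (hB : B2 ⊆ B1) (hT : T ⊆ A1) (hT' : T' ⊆ B1)
    (hq : HInv D A2 B2 q (2 * s)) (hq' : HInv D B2 A2 q' (2 * s))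
    (hdis : Disjoint A2 (B2 + D))
    (hA1 : #A1 ≤ a) (hA2 : a ≤ #A2 + 2 * s * t) (hB1 : #B1 ≤ b) (hB2 : b ≤ #B2 + 2 * s * t)
    (hN : Fintype.card F ≤ a + b + t)
    (hgA : #(A1 + bl D (13 * s)) ≤ #A1 + kap * s * t)
    (hgB : #(B1 + bl D (21 * s)) ≤ #B1 + kap * s * t)
    (hgrow : s * #D ≤ 2 * #(bl D s)) :
    #(both D L (Pset D q T s) (Pset D q' T' s) s) * #D ≤ (4 * kap + 18) * t := by
  set P := Pset D q T s with hP
  set P' := Pset D q' T' s with hP'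
  let X := (P + bl D (3 * s)) ∩ (P' + D + bl D (9 * s))
  have h1 : #(both D L P P' s) * #(bl D s) ≤ #X := by
    apply sep_card hs
    · intro x hx y hy
      exact hL x (mem_filter.1 hx).1 y (mem_filter.1 hy).1
    · intro x hx u hu
      obtain ⟨_, hx1, hx2⟩ := mem_filter.1 hx
      have e1 : 3 * s = 2 * s + s := by ring
      have e2 : 9 * s = 8 * s + s := by ring
      rw [mem_inter, e1, e2, ← thick_thick, ← thick_thick]
      exact ⟨add_mem_add hx1 hu, add_mem_add hx2 hu⟩
  have hPc : ∀ y ∈ P + bl D (3 * s), y ∈ A1 + bl D (13 * s) ∨ y ∉ B2 + D := by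
    intro y hy
    rw [hP, Pset, union_add, thick_thick, thick_thick] at hy
    rcases mem_union.1 hy with hy | hy
    · obtain ⟨z, hz, hyz⟩ := mem_thick.1 hy
      rcases hq.2 z hz with h | h
      · left
        have := mem_thick_of hs h hyz
        rw [thick_thick] at this
        exact thick_mono hs hD hA (by omega) this
      · right
        intro hyB
        apply h
        exact thick_mono hs hD (le_refl _) (by omega) (mem_thick_of hs hyB (bl_sub_comm hs hyz))
    · left
      exact thick_mono hs hD hT (by omega) hy
  have hPc' : ∀ y ∈ P' + D + bl D (9 * s), y ∈ B1 + D + bl D (20 * s) ∨ y ∉ A2 := by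
    intro y hy
    rw [hP', Pset, union_add, union_add, thickD_thick, thickD_thick] at hy
    rcases mem_union.1 hy with hy | hy
    · rw [add_assoc] at hy
      obtain ⟨z, hz, hyz⟩ := mem_thick.1 hy
      rcases hq'.2 z hz with h | h
      · left
        have := add_mem_add h hyz
        rw [add_sub_cancel, ← add_assoc, thickD_thick] at this
        exact thick_mono hs hD (add_subset_add_right hB) (by omega) this
      · right
        intro hyA
        apply h
        obtain ⟨δ, hδ, v, hv, e⟩ := mem_add.1 hyz
        have : z = y + (-δ) + (-v) := by
          rw [show z = y - (y - z) by abel, ← e]; abel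
        rw [this]
        have := add_mem_add (add_mem_add hyA (hs δ hδ)) (neg_mem_bl hs _ _ hv)
        exact thick_mono hs hD (le_refl _) (by omega) this
    · left
      exact thick_mono hs hD (add_subset_add_right hT') (by omega) hy
  have hX : X ⊆ ((A1 + bl D (13 * s)) \ A2) ∪ (((B1 + D + bl D (20 * s)) \ (B2 + D)) ∪
      (A2 ∪ (B2 + D))ᶜ) := by
    intro y hy
    obtain ⟨hy1, hy2⟩ := mem_inter.1 hy
    have c1 := hPc y hy1
    have c2 := hPc' y hy2
    have c3 : y ∈ A2 → y ∉ B2 + D := fun h => disjoint_left.1 hdis h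
    simp only [mem_union, mem_sdiff, mem_compl]
    tauto
  have k1 : #((A1 + bl D (13 * s)) \ A2) + #A2 = #(A1 + bl D (13 * s)) :=
    card_sdiff_add_card_eq_card (hA.trans (subset_add_left _ (zero_mem_bl hs hD _)))
  have k2 : #((B1 + D + bl D (20 * s)) \ (B2 + D)) + #(B2 + D) = #(B1 + D + bl D (20 * s)) :=
    card_sdiff_add_card_eq_card
      ((add_subset_add_right hB).trans (subset_add_left _ (zero_mem_bl hs hD _)))
  have k3 : #(B1 + D + bl D (20 * s)) ≤ #(B1 + bl D (21 * s)) := by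
    refine (card_le_card_add hD _).trans (card_le_card ?_)
    have : B1 + D + bl D (20 * s) + D = B1 + bl D (20 * s + 1) := by rw [bl]; abel
    rw [this]
    exact thick_mono hs hD (le_refl _) (by omega)
  have k4 := card_le_card_add hD B2
  have k5 : #(A2 ∪ (B2 + D))ᶜ + (#A2 + #(B2 + D)) = Fintype.card F := by
    rw [← card_union_of_disjoint hdis, card_compl_add_card]
  have hXc : #X ≤ (2 * kap + 9) * (s * t) := by
    have h2 := card_le_card hX
    have h3 := card_union_le ((A1 + bl D (13 * s)) \ A2) (((B1 + D + bl D (20 * s)) \ (B2 + D)) ∪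
      (A2 ∪ (B2 + D))ᶜ)
    have h4 := card_union_le ((B1 + D + bl D (20 * s)) \ (B2 + D)) (A2 ∪ (B2 + D))ᶜ
    have h5 : t ≤ s * t := Nat.le_mul_of_pos_left _ hs1
    have e1 : (2 * kap + 9) * (s * t) = 2 * (kap * s * t) + 9 * (s * t) := by ring
    have e2 : 2 * s * t = 2 * (s * t) := by ring
    rw [e1]; rw [e2] at hA2 hB2
    omega
  set bc := #(both D L P P' s)
  have : s * (bc * #D) ≤ s * ((4 * kap + 18) * t) := by
    calc s * (bc * #D) = bc * (s * #D) := by ring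
      _ ≤ bc * (2 * #(bl D s)) := Nat.mul_le_mul_left _ hgrow
      _ = 2 * (bc * #(bl D s)) := by ring
      _ ≤ 2 * ((2 * kap + 9) * (s * t)) := Nat.mul_le_mul_left _ (h1.trans hXc)
      _ = _ := by ring
  exact Nat.le_of_mul_le_mul_left this hs1

/-- successors of a state -/
def next (D L : Finset F) (s b : ℕ) (T T' : Finset F) (p : Finset F × Finset F) :
    Finset (Finset F × Finset F) :=
  if #(both D L (Pset D p.1 T s) (Pset D p.2 T' s) s) ≤ b ∧
     #(both D L (Pset D p.2 T' s) (Pset D p.1 T s) s) ≤ b then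
    ((both D L (Pset D p.1 T s) (Pset D p.2 T' s) s).powerset ×ˢ
     (both D L (Pset D p.2 T' s) (Pset D p.1 T s) s).powerset).image
      (fun U => (only D L (Pset D p.1 T s) (Pset D p.2 T' s) s ∪ U.1,
                 only D L (Pset D p.2 T' s) (Pset D p.1 T s) s ∪ U.2))
  else ∅

lemma card_next (L : Finset F) (s b : ℕ) (T T' : Finset F) (p : Finset F × Finset F) :
    #(next D L s b T T' p) ≤ 2 ^ (2 * b) := by
  unfold next
  split_ifs with h
  · refine card_image_le.trans ?_
    rw [card_product, card_powerset, card_powerset, two_mul, pow_add]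
    exact Nat.mul_le_mul (Nat.pow_le_pow_right (by norm_num) h.1)
      (Nat.pow_le_pow_right (by norm_num) h.2)
  · simp

/-- decoding the code -/
def fr (Q : Finset (ℕ × F × Bool)) (j : ℕ) (c : Bool) : Finset F :=
  univ.filter (fun x => (j, x, c) ∈ Q)

def Fam (D : Finset F) (L : ℕ → Finset F) (J b : ℕ) (Q : Finset (ℕ × F × Bool)) :
    ℕ → Finset (Finset F × Finset F)
  | 0 => {(fr Q J true, fr Q J false)}
  | i + 1 => (Fam D L J b Q i).biUnion
      (next D (L (J - (i + 1))) (2 ^ (J - (i + 1))) b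
        (fr Q (J - (i + 1)) true) (fr Q (J - (i + 1)) false))

lemma card_Fam (L : ℕ → Finset F) (J b : ℕ) (Q : Finset (ℕ × F × Bool)) (i : ℕ) :
    #(Fam D L J b Q i) ≤ (2 ^ (2 * b)) ^ i := by
  induction i with
  | zero => simp [Fam]
  | succ i ih =>
    rw [Fam, pow_succ]
    refine (card_biUnion_le_card_mul _ _ _ (fun p _ => card_next _ _ _ _ _ p)).trans ?_
    exact Nat.mul_le_mul_right _ ih

set_option maxHeartbeats 1000000 in
/-- Multi-scale coding lemma. -/
lemma multiscale (hs : ∀ x ∈ D, -x ∈ D) (hD : D.Nonempty) (hN : Fintype.card F ≤ 2 * hh D) (J : ℕ)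
    (hJ : hh D ≤ #(bl D (2 ^ J))) (hJ' : ∀ j < J, #(bl D (2 ^ j)) < hh D) (t : ℕ) :
    ∃ 𝒢 : Finset (Finset F),
      #𝒢 ≤ ((J + 1) * (Fintype.card F * 2) + 1) ^ (32 * t / #D) *
        (2 ^ (2 * ((4 * kap + 18) * t / #D))) ^ J ∧
      ∀ A : Finset F, tt D A = t → (A + D)ᶜ + D = Aᶜ → #D ≤ 2 * t →
        ∃ Gh ∈ 𝒢, #(Gh \ (A + D)) ≤ t ∧ #((A + D) \ Gh) ≤ (kap + 2) * t := by
  have hd : 0 < #D := card_pos.2 hD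
  choose L hLsub hLs hLn using fun j => net hs hD (univ : Finset F) (2 ^ j)
  let b := (4 * kap + 18) * t / #D
  let X : Finset (ℕ × F × Bool) := range (J + 1) ×ˢ (univ ×ˢ univ)
  have hX : #X = (J + 1) * (Fintype.card F * 2) := by
    simp [X, card_product]
  let 𝒬 := X.powerset.filter (fun Q => #Q ≤ 32 * t / #D)
  refine ⟨𝒬.biUnion (fun Q => (Fam D L J b Q J).image (fun p => (p.2 + bl D 2)ᶜ)), ?_, ?_⟩
  · refine (card_biUnion_le_card_mul _ _ ((2 ^ (2 * b)) ^ J) ?_).trans ?_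
    · intro Q _
      exact card_image_le.trans (card_Fam _ _ _ _ _)
    · apply Nat.mul_le_mul_right
      rw [← hX]
      exact card_small X _
  intro A htA hdual hdt
  set B := (A + D)ᶜ with hB
  have hcA := tt_add hD A
  have hcB := tt_add hD B
  have hNB : #B + #(A + D) = Fintype.card F := by rw [hB, card_compl_add_card]
  have hNA : #(B + D) + #A = Fintype.card F := by rw [hdual, card_compl_add_card]
  have htB : tt D B = t := by omega
  obtain ⟨Ac, T, hAcA, hAcm, hAcc, hAcg, hAcn, hAcJ, hTA, hTsum⟩ := chain hs hD hN J hJ hJ' A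
  obtain ⟨Bc, T', hBcB, hBcm, hBcc, hBcg, hBcn, hBcJ, hTB, hTsum'⟩ := chain hs hD hN J hJ hJ' B
  rw [htA] at hAcc hAcg hTsum
  rw [htB] at hBcc hBcg hTsum'
  have hdis : Disjoint A (B + D) := by rw [hdual]; exact disjoint_compl_right
  have hdis' : Disjoint B (A + D) := by rw [hB]; exact disjoint_compl_left
  -- the code
  let Q : Finset (ℕ × F × Bool) := X.filter (fun p => if p.2.2 then p.2.1 ∈ T p.1 else p.2.1 ∈ T' p.1)
  have hfr1 : ∀ j ≤ J, fr Q j true = T j := by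
    intro j hj
    ext x
    simp [fr, Q, X]; omega
  have hfr2 : ∀ j ≤ J, fr Q j false = T' j := by
    intro j hj
    ext x
    simp [fr, Q, X]; omega
  have hQcard : #Q ≤ ∑ j ∈ range (J + 1), #(T j) + ∑ j ∈ range (J + 1), #(T' j) := by
    have hsub : Q ⊆ ((range (J + 1)).biUnion (fun j => (T j).image (fun x => (j, x, true)))) ∪
        ((range (J + 1)).biUnion (fun j => (T' j).image (fun x => (j, x, false)))) := by
      rintro ⟨j, x, c⟩ h
      simp only [Q, X, mem_filter, mem_product, mem_univ, and_true] at h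
      obtain ⟨h1, h2⟩ := h
      cases c
      · apply mem_union_right
        exact mem_biUnion.2 ⟨j, h1, mem_image.2 ⟨x, by simpa using h2, rfl⟩⟩
      · apply mem_union_left
        exact mem_biUnion.2 ⟨j, h1, mem_image.2 ⟨x, by simpa using h2, rfl⟩⟩
    refine (card_le_card hsub).trans ((card_union_le _ _).trans ?_)
    apply Nat.add_le_add
    · exact card_biUnion_le.trans (sum_le_sum (fun j _ => card_image_le))
    · exact card_biUnion_le.trans (sum_le_sum (fun j _ => card_image_le))
  have hQmem : Q ∈ 𝒬 := by
    refine mem_filter.2 ⟨mem_powerset.2 (filter_subset _ _), ?_⟩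
    rw [Nat.le_div_iff_mul_le hd]
    have := Nat.mul_le_mul_right (#D) hQcard
    rw [add_mul, mul_comm _ (#D), mul_comm _ (#D)] at this
    nlinarith
  -- the run
  have hrun : ∀ i ≤ J, ∃ p ∈ Fam D L J b Q i, HInv D (Ac (J - i)) (Bc (J - i)) p.1 (2 ^ (J - i)) ∧
      HInv D (Bc (J - i)) (Ac (J - i)) p.2 (2 ^ (J - i)) := by
    intro i
    induction i with
    | zero =>
      intro _
      refine ⟨_, mem_singleton_self _, ?_⟩
      simp only [hfr1 J le_rfl, hfr2 J le_rfl, Nat.sub_zero]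
      refine ⟨⟨?_, ?_⟩, ⟨?_, ?_⟩⟩
      · rw [mul_comm, ← pow_succ]; exact hAcJ
      · intro z hz; left
        exact subset_add_left _ (zero_mem_bl hs hD _) (hTA J hz)
      · rw [mul_comm, ← pow_succ]; exact hBcJ
      · intro z hz; left
        exact subset_add_left _ (zero_mem_bl hs hD _) (hTB J hz)
    | succ i ih =>
      intro hi
      obtain ⟨p, hp, hp1, hp2⟩ := ih (by omega)
      obtain ⟨j, hj⟩ : ∃ j, j = J - (i + 1) := ⟨_, rfl⟩
      have hj1 : J - i = j + 1 := by omega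
      have hjJ : j < J := by omega
      rw [hj1] at hp1 hp2
      have e2 : 2 ^ (j + 1) = 2 * 2 ^ j := by rw [pow_succ, mul_comm]
      have e4 : 2 ^ (j + 2) = 4 * 2 ^ j := by rw [pow_add, mul_comm]; norm_num
      rw [← hj]
      set s := 2 ^ j with hsdef
      have hs1 : 1 ≤ s := Nat.one_le_two_pow
      rw [e2] at hp1 hp2
      have hAn := hAcn j hjJ
      have hBn := hBcn j hjJ
      rw [e2, e4] at hAn hBn
      have hPA := step_sub hs hD hp1.1 hAn
      have hPB := step_sub hs hD hp2.1 hBn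
      have hL2 : ∀ x : F, x ∈ L j + bl D (2 * s) := fun x => hLn j (mem_univ x)
      have i1 := step_inv hs hD hL2 hPA hPB
      have i2 := step_inv hs hD hL2 hPB hPA
      have hgrow : s * #D ≤ 2 * #(bl D s) := by
        rcases bl_grow hs hD s with h | h
        · have := hJ' j hjJ; rw [← hsdef] at this; omega
        · omega
      have hA2 := hAcc (j + 1)
      have hB2 := hBcc (j + 1)
      rw [e2] at hA2 hB2
      have b1 : #(both D (L j) (Pset D p.1 (T j) s) (Pset D p.2 (T' j) s) s) ≤ b := by
        rw [Nat.le_div_iff_mul_le hd]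
        exact step_count hs hD hs1 (hLs j) (hAcm j) (hBcm j) (hTA j) (hTB j) hp1 hp2
          (hdis.mono (hAcA _) (add_subset_add_right (hBcB _)))
          (card_le_card (hAcA j)) hA2 (card_le_card (hBcB j)) hB2 (by omega)
          (hAcg j _ (by omega)) (hBcg j _ (by omega)) hgrow
      have b2 : #(both D (L j) (Pset D p.2 (T' j) s) (Pset D p.1 (T j) s) s) ≤ b := by
        rw [Nat.le_div_iff_mul_le hd]
        exact step_count hs hD hs1 (hLs j) (hBcm j) (hAcm j) (hTB j) (hTA j) hp2 hp1
          (hdis'.mono (hBcB _) (add_subset_add_right (hAcA _)))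
          (card_le_card (hBcB j)) hB2 (card_le_card (hAcA j)) hA2 (by omega)
          (hBcg j _ (by omega)) (hAcg j _ (by omega)) hgrow
      refine ⟨(only D (L j) (Pset D p.1 (T j) s) (Pset D p.2 (T' j) s) s ∪
          (both D (L j) (Pset D p.1 (T j) s) (Pset D p.2 (T' j) s) s).filter
            (fun z => z ∈ Ac j + bl D (2 * s)),
          only D (L j) (Pset D p.2 (T' j) s) (Pset D p.1 (T j) s) s ∪
          (both D (L j) (Pset D p.2 (T' j) s) (Pset D p.1 (T j) s) s).filter
            (fun z => z ∈ Bc j + bl D (2 * s))), ?_, i1, i2⟩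
      rw [Fam, mem_biUnion]
      refine ⟨p, hp, ?_⟩
      rw [← hj, hfr1 j hjJ.le, hfr2 j hjJ.le, next, if_pos ⟨b1, b2⟩]
      exact mem_image.2 ⟨((both D (L j) (Pset D p.1 (T j) s) (Pset D p.2 (T' j) s) s).filter
            (fun z => z ∈ Ac j + bl D (2 * s)),
          (both D (L j) (Pset D p.2 (T' j) s) (Pset D p.1 (T j) s) s).filter
            (fun z => z ∈ Bc j + bl D (2 * s))),
        mem_product.2 ⟨mem_powerset.2 (filter_subset _ _),
        mem_powerset.2 (filter_subset _ _)⟩, rfl⟩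
  obtain ⟨p, hp, -, hp2⟩ := hrun J le_rfl
  simp only [Nat.sub_self, pow_zero, mul_one] at hp2
  refine ⟨(p.2 + bl D 2)ᶜ, mem_biUnion.2 ⟨Q, hQmem, mem_image.2 ⟨p, hp, rfl⟩⟩, ?_, ?_⟩
  · have h1 : (p.2 + bl D 2)ᶜ \ (A + D) ⊆ B \ Bc 0 := by
      intro y hy
      obtain ⟨h1, h2⟩ := mem_sdiff.1 hy
      refine mem_sdiff.2 ⟨mem_compl.2 h2, fun h => ?_⟩
      exact (mem_compl.1 h1) (hp2.1 h)
    have h2 := card_le_card h1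
    have h3 := card_sdiff_add_card_eq_card (hBcB 0)
    have h4 := hBcc 0
    simp at h4
    omega
  · have h1 : (A + D) \ (p.2 + bl D 2)ᶜ ⊆ ((Bc 0 + bl D 4) \ Bc 0) ∪ ((A + D) \ (Ac 0 + D)) := by
      intro y hy
      obtain ⟨h1, h2⟩ := mem_sdiff.1 hy
      rw [mem_compl, not_not] at h2
      obtain ⟨z, hz, hyz⟩ := mem_thick.1 h2
      rcases hp2.2 z hz with h | h
      · apply mem_union_left
        have := mem_thick_of hs h hyz
        rw [thick_thick] at this
        exact mem_sdiff.2 ⟨this, fun h' => (mem_compl.1 (hBcB 0 h')) h1⟩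
      · apply mem_union_right
        refine mem_sdiff.2 ⟨h1, fun h' => h ?_⟩
        exact thick_mono hs hD (le_refl _) (by omega) (mem_thick_of hs h' (bl_sub_comm hs hyz))
    have h2 := card_le_card h1
    have h3 := card_union_le ((Bc 0 + bl D 4) \ Bc 0) ((A + D) \ (Ac 0 + D))
    have h4 := card_sdiff_add_card_eq_card
      (subset_add_left (Bc 0) (zero_mem_bl hs hD 4) : Bc 0 ⊆ Bc 0 + bl D 4)
    have h5 := card_sdiff_add_card_eq_card (add_subset_add_right (t := D) (hAcA 0))
    have h6 := hBcg 0 4 (by norm_num)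
    have h7 := hAcc 0
    have h8 := card_le_card_add hD (Ac 0)
    simp only [pow_zero, one_mul, mul_one] at h6 h7
    rw [add_mul]
    omega

end coding
end ACG

namespace ACG
set_option linter.unusedSectionVars false
set_option linter.unusedVariables false
open Finset

section greedy
variable {F : Type*} [AddCommGroup F] [Fintype F] [DecidableEq F] {D : Finset F}

/-- number of neighbours of `x` in `Y` -/
def dg (D : Finset F) (x : F) (Y : Finset F) : ℕ := #(Y.filter (fun y => y - x ∈ D))

/-- number of (ordered) edges -/
def ee (D X Y : Finset F) : ℕ := ∑ x ∈ X, dg D x Y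

lemma dg_univ (x : F) : dg D x univ = #D := by
  unfold dg
  apply card_bij (fun y _ => y - x)
  · intro y hy; exact (mem_filter.1 hy).2
  · intro a _ b _ h; simpa using h
  · intro δ hδ; exact ⟨δ + x, mem_filter.2 ⟨mem_univ _, by simpa using hδ⟩, by simp⟩

lemma dg_mono (x : F) {Y Z : Finset F} (h : Y ⊆ Z) : dg D x Y ≤ dg D x Z :=
  card_le_card (filter_subset_filter _ h)

lemma dg_union_le (x : F) (Y Z : Finset F) : dg D x (Y ∪ Z) ≤ dg D x Y + dg D x Z := by
  unfold dg; rw [filter_union]; exact card_union_le _ _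

lemma dg_compl (x : F) (Y : Finset F) : dg D x Y + dg D x Yᶜ = #D := by
  rw [← dg_univ (D := D) x]
  unfold dg
  rw [← card_union_of_disjoint, ← filter_union, union_compl]
  exact disjoint_filter_filter disjoint_compl_right

lemma dg_eq_zero (x : F) {Y : Finset F} (h : ∀ y ∈ Y, y - x ∉ D) : dg D x Y = 0 := by
  unfold dg; rw [card_eq_zero, filter_eq_empty_iff]; exact fun y hy => h y hy

lemma ee_comm (hs : ∀ x ∈ D, -x ∈ D) (X Y : Finset F) : ee D X Y = ee D Y X := by
  unfold ee dg
  simp only [card_filter]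
  rw [sum_comm]
  apply sum_congr rfl; intro y _; apply sum_congr rfl; intro x _
  congr 1
  exact propext ⟨D_sub_comm hs, D_sub_comm hs⟩

lemma ee_mono {X X' Y Y' : Finset F} (h : X ⊆ X') (h' : Y ⊆ Y') : ee D X Y ≤ ee D X' Y' := by
  unfold ee
  exact (sum_le_sum (fun x _ => dg_mono x h')).trans (sum_le_sum_of_subset h)

lemma ee_compl (X Y : Finset F) : ee D X Y + ee D X Yᶜ = #X * #D := by
  unfold ee
  rw [← sum_add_distrib]
  simp [dg_compl]

lemma ee_le (X Y : Finset F) : ee D X Y ≤ #X * #D := by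
  have := ee_compl (D := D) X Y; omega

lemma ee_closed (hD : D.Nonempty) {A : Finset F} (Z : Finset F) (h : Z ⊆ (A + D)ᶜ) :
    ee D A Z = 0 := by
  unfold ee
  apply sum_eq_zero
  intro x hx
  apply dg_eq_zero
  intro y hy hyx
  exact mem_compl.1 (h hy) (mem_thick.2 ⟨x, hx, hyx⟩)

lemma ee_out (hs : ∀ x ∈ D, -x ∈ D) (hD : D.Nonempty) (A : Finset F) :
    ee D Aᶜ (A + D) = #D * tt D A := by
  have h1 := ee_compl (D := D) (A + D) A
  have h2 := ee_compl (D := D) A (A + D)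
  have h3 := ee_closed hD (A := A) (A + D)ᶜ (le_refl _)
  rw [ee_comm hs (A + D) A, ee_comm hs (A + D) Aᶜ] at h1
  have h4 := tt_add hD A
  rw [← h4, add_mul] at h1
  rw [mul_comm]
  omega

/-- vertices outside `A` with many neighbours in `A + D` -/
lemma few_out (hs : ∀ x ∈ D, -x ∈ D) (hD : D.Nonempty) (A X : Finset F) (hX : Disjoint X A)
    (h : ∀ x ∈ X, #D ≤ 2 * dg D x (A + D)) : #X ≤ 2 * tt D A := by
  have h1 : #X * #D ≤ 2 * ee D X (A + D) := by
    unfold ee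
    rw [mul_sum, ← smul_eq_mul, ← sum_const]
    exact sum_le_sum h
  have h2 : ee D X (A + D) ≤ ee D Aᶜ (A + D) :=
    ee_mono (fun x hx => mem_compl.2 (disjoint_left.1 hX hx)) (le_refl _)
  rw [ee_out hs hD] at h2
  have : #D * #X ≤ #D * (2 * tt D A) := by nlinarith
  exact Nat.le_of_mul_le_mul_left this (card_pos.2 hD)

lemma few_in (hs : ∀ x ∈ D, -x ∈ D) (hD : D.Nonempty) (A Y : Finset F) (hY : Y ⊆ A + D)
    (h : ∀ y ∈ Y, 2 * dg D y A ≤ #D) : #Y ≤ 2 * tt D A := by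
  have h1 : #Y * #D ≤ 2 * ee D Y Aᶜ := by
    unfold ee
    rw [mul_sum, ← smul_eq_mul, ← sum_const]
    apply sum_le_sum
    intro y hy
    have := h y hy
    have := dg_compl (D := D) y A
    omega
  have h2 : ee D Y Aᶜ ≤ ee D (A + D) Aᶜ := ee_mono hY (le_refl _)
  rw [ee_comm hs (A + D), ee_out hs hD] at h2
  have : #D * #Y ≤ #D * (2 * tt D A) := by nlinarith
  exact Nat.le_of_mul_le_mul_left this (card_pos.2 hD)

lemma greedy (A W0 : Finset F) (ψ : ℕ) : ∃ T ⊆ A, #T * (ψ + 1) ≤ #((A + D) \ W0) ∧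
    ∀ x ∈ A, dg D x (W0 ∪ (T + D))ᶜ ≤ ψ := by
  let S := A.powerset.filter (fun T => #T * (ψ + 1) ≤ #((T + D) \ W0))
  obtain ⟨T, hT, hmax⟩ := S.exists_max_image card ⟨∅, by simp [S]⟩
  simp only [S, mem_filter, mem_powerset] at hT hmax
  refine ⟨T, hT.1, hT.2.trans (card_le_card (sdiff_subset_sdiff (add_subset_add_right hT.1) (le_refl _))), ?_⟩
  intro x hx
  by_contra hcon
  push Not at hcon
  have hxT : x ∉ T := by
    intro h
    have : dg D x (W0 ∪ (T + D))ᶜ = 0 := by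
      apply dg_eq_zero
      intro y hy hyx
      exact mem_compl.1 hy (mem_union_right _ (mem_thick.2 ⟨x, h, hyx⟩))
    omega
  have h1 : #((T + D) \ W0) + dg D x (W0 ∪ (T + D))ᶜ ≤ #((insert x T + D) \ W0) := by
    unfold dg
    rw [← card_union_of_disjoint]
    · apply card_le_card
      apply union_subset
      · exact sdiff_subset_sdiff (add_subset_add_right (subset_insert _ _)) (le_refl _)
      · intro y hy
        obtain ⟨hy1, hy2⟩ := mem_filter.1 hy
        rw [mem_compl, mem_union, not_or] at hy1
        exact mem_sdiff.2 ⟨mem_thick.2 ⟨x, mem_insert_self _ _, hy2⟩, hy1.1⟩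
    · rw [disjoint_left]
      intro y hy hy'
      have := (mem_filter.1 hy').1
      rw [mem_compl, mem_union, not_or] at this
      exact this.2 (mem_sdiff.1 hy).1
  have := hmax (insert x T) ⟨insert_subset hx hT.1, by
    rw [card_insert_of_notMem hxT, add_mul]; omega⟩
  rw [card_insert_of_notMem hxT] at this
  omega

def dS1 (D : Finset F) (ψ : ℕ) (Gh T1 : Finset F) : Finset F :=
  univ.filter (fun x => dg D x (Gh ∪ (T1 + D))ᶜ ≤ ψ)
def dS2 (D : Finset F) (ψ : ℕ) (Gh T1 T2 : Finset F) : Finset F := dS1 D ψ Gh T1 \ (T2 + D)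
def dW (D : Finset F) (ψ : ℕ) (Gh T1 T2 T3 : Finset F) : Finset F :=
  univ.filter (fun y => ψ < dg D y (dS2 D ψ Gh T1 T2)) ∪ (T3 + D)
def dS (D : Finset F) (ψ : ℕ) (Gh T1 T2 T3 : Finset F) : Finset F :=
  (dS2 D ψ Gh T1 T2).filter (fun x => dg D x (dW D ψ Gh T1 T2 T3)ᶜ ≤ ψ)

lemma passes (hs : ∀ x ∈ D, -x ∈ D) (hD : D.Nonempty) (ψ κ : ℕ) (hψ : 2 * ψ ≤ #D)
    (A Gh : Finset F) (hdual : (A + D)ᶜ + D = Aᶜ)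
    (h1 : #(Gh \ (A + D)) ≤ tt D A) (h2 : #((A + D) \ Gh) ≤ κ * tt D A) :
    ∃ T1 T2 T3 : Finset F, #T1 * (ψ + 1) ≤ κ * tt D A ∧ #T2 * (ψ + 1) ≤ 4 * tt D A ∧
      #T3 * (ψ + 1) ≤ 2 * tt D A ∧
      A ⊆ dS D ψ Gh T1 T2 T3 ∧ dW D ψ Gh T1 T2 T3 ⊆ A + D ∧
      #(A + D) ≤ #(dW D ψ Gh T1 T2 T3) + 2 * tt D A ∧
      ee D (dS D ψ Gh T1 T2 T3) (dW D ψ Gh T1 T2 T3)ᶜ ≤ 4 * ψ * tt D A := by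
  have hd : 0 < #D := card_pos.2 hD
  -- pass 1
  obtain ⟨T1, hT1, hT1c, hT1g⟩ := greedy (D := D) A Gh ψ
  have hAS1 : A ⊆ dS1 D ψ Gh T1 := fun x hx => mem_filter.2 ⟨mem_univ _, hT1g x hx⟩
  have hS1c : #(dS1 D ψ Gh T1 \ A) ≤ 4 * tt D A := by
    have key : ∀ x ∈ dS1 D ψ Gh T1 \ A, #D ≤ 2 * (dg D x (A + D) + dg D x (Gh \ (A + D))) := by
      intro x hx
      have hx1 := (mem_filter.1 (mem_sdiff.1 hx).1).2
      have e1 := dg_compl (D := D) x (Gh ∪ (T1 + D))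
      have e2 : dg D x (Gh ∪ (T1 + D)) ≤ dg D x ((A + D) ∪ (Gh \ (A + D))) := by
        apply dg_mono
        intro y hy
        by_cases hyA : y ∈ A + D
        · exact mem_union_left _ hyA
        · rcases mem_union.1 hy with h | h
          · exact mem_union_right _ (mem_sdiff.2 ⟨h, hyA⟩)
          · exact absurd (add_subset_add_right hT1 h) hyA
      have e3 := dg_union_le (D := D) x (A + D) (Gh \ (A + D))
      omega
    have s1 : #(dS1 D ψ Gh T1 \ A) * #D ≤
        2 * (ee D (dS1 D ψ Gh T1 \ A) (A + D) + ee D (dS1 D ψ Gh T1 \ A) (Gh \ (A + D))) := by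
      unfold ee
      rw [← sum_add_distrib, mul_sum, ← smul_eq_mul, ← sum_const]
      exact sum_le_sum key
    have s2 : ee D (dS1 D ψ Gh T1 \ A) (A + D) ≤ #D * tt D A := by
      rw [← ee_out hs hD]
      exact ee_mono (fun x hx => mem_compl.2 (mem_sdiff.1 hx).2) (le_refl _)
    have s3 : ee D (dS1 D ψ Gh T1 \ A) (Gh \ (A + D)) ≤ tt D A * #D := by
      rw [ee_comm hs]
      exact (ee_le _ _).trans (Nat.mul_le_mul_right _ h1)
    have : #D * #(dS1 D ψ Gh T1 \ A) ≤ #D * (4 * tt D A) := by nlinarith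
    exact Nat.le_of_mul_le_mul_left this hd
  -- pass 2
  obtain ⟨T2, hT2, hT2c, hT2g⟩ := greedy (D := D) (A + D)ᶜ (dS1 D ψ Gh T1)ᶜ ψ
  have hT2D : T2 + D ⊆ Aᶜ := by rw [← hdual]; exact add_subset_add_right hT2
  have hc2 : #T2 * (ψ + 1) ≤ 4 * tt D A := by
    refine hT2c.trans (le_trans (card_le_card ?_) hS1c)
    rw [hdual]
    intro x hx
    obtain ⟨a, b⟩ := mem_sdiff.1 hx
    rw [mem_compl, not_not] at b
    exact mem_sdiff.2 ⟨b, mem_compl.1 a⟩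
  have hAS2 : A ⊆ dS2 D ψ Gh T1 T2 := fun x hx =>
    mem_sdiff.2 ⟨hAS1 hx, fun h => mem_compl.1 (hT2D h) hx⟩
  have hW2 : univ.filter (fun y => ψ < dg D y (dS2 D ψ Gh T1 T2)) ⊆ A + D := by
    intro y hy
    by_contra hyA
    have e1 := hT2g y (mem_compl.2 hyA)
    have e2 := (mem_filter.1 hy).2
    have e3 : dS2 D ψ Gh T1 T2 = ((dS1 D ψ Gh T1)ᶜ ∪ (T2 + D))ᶜ := by
      ext x; simp [dS2]
    rw [← e3] at e1
    omega
  have hW2c : #((A + D) \ univ.filter (fun y => ψ < dg D y (dS2 D ψ Gh T1 T2))) ≤ 2 * tt D A := by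
    apply few_in hs hD A _ sdiff_subset
    intro y hy
    have e1 := (mem_sdiff.1 hy).2
    simp only [mem_filter, mem_univ, true_and, not_lt] at e1
    have e2 := dg_mono (D := D) y hAS2
    omega
  -- pass 3
  obtain ⟨T3, hT3, hT3c, hT3g⟩ := greedy (D := D) A
    (univ.filter (fun y => ψ < dg D y (dS2 D ψ Gh T1 T2))) ψ
  have hWG : dW D ψ Gh T1 T2 T3 ⊆ A + D := union_subset hW2 (add_subset_add_right hT3)
  have hAS : A ⊆ dS D ψ Gh T1 T2 T3 := fun x hx => mem_filter.2 ⟨hAS2 hx, hT3g x hx⟩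
  have hGW : #((A + D) \ dW D ψ Gh T1 T2 T3) ≤ 2 * tt D A :=
    (card_le_card (sdiff_subset_sdiff (le_refl _) subset_union_left)).trans hW2c
  refine ⟨T1, T2, T3, hT1c.trans h2, hc2, hT3c.trans hW2c, hAS, hWG, ?_, ?_⟩
  · have := card_sdiff_add_card_eq_card hWG
    omega
  · have hSA : #(dS D ψ Gh T1 T2 T3 \ A) ≤ 2 * tt D A := by
      apply few_out hs hD _ _ sdiff_disjoint
      intro x hx
      have e1 := (mem_filter.1 (mem_sdiff.1 hx).1).2
      have e2 := dg_compl (D := D) x (dW D ψ Gh T1 T2 T3)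
      have e3 := dg_mono (D := D) x hWG
      omega
    set S := dS D ψ Gh T1 T2 T3 with hS
    set W := dW D ψ Gh T1 T2 T3 with hW
    have e1 : ee D S Wᶜ = ee D (S \ A) Wᶜ + ee D A Wᶜ := by
      unfold ee; rw [sum_sdiff hAS]
    have e2 : ee D (S \ A) Wᶜ ≤ #(S \ A) * ψ := by
      unfold ee
      rw [← smul_eq_mul]
      apply sum_le_card_nsmul
      intro x hx
      exact (mem_filter.1 (mem_sdiff.1 hx).1).2
    have e3 : ee D A Wᶜ ≤ ee D A ((A + D) \ W) := by
      unfold ee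
      apply sum_le_sum
      intro x hx
      apply card_le_card
      intro y hy
      obtain ⟨a, b⟩ := mem_filter.1 hy
      exact mem_filter.2 ⟨mem_sdiff.2 ⟨mem_thick.2 ⟨x, hx, b⟩, mem_compl.1 a⟩, b⟩
    have e4 : ee D A ((A + D) \ W) ≤ #((A + D) \ W) * ψ := by
      rw [ee_comm hs]
      unfold ee
      rw [← smul_eq_mul]
      apply sum_le_card_nsmul
      intro y hy
      have h' : y ∉ univ.filter (fun y => ψ < dg D y (dS2 D ψ Gh T1 T2)) := fun h =>
        (mem_sdiff.1 hy).2 (mem_union_left _ h)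
      simp only [mem_filter, mem_univ, true_and, not_lt] at h'
      exact (dg_mono y hAS2).trans h'
    have e5 := Nat.mul_le_mul_right ψ hSA
    have e6 := Nat.mul_le_mul_right ψ hGW
    calc ee D S Wᶜ ≤ 2 * tt D A * ψ + 2 * tt D A * ψ := by omega
      _ = _ := by ring

/-- Container family for closed sets with given defect. -/
lemma containers (hs : ∀ x ∈ D, -x ∈ D) (hD : D.Nonempty) (hN : Fintype.card F ≤ 2 * hh D) (J : ℕ)
    (hJ : hh D ≤ #(bl D (2 ^ J))) (hJ' : ∀ j < J, #(bl D (2 ^ j)) < hh D) (t ψ : ℕ)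
    (hψ : 2 * ψ ≤ #D) :
    ∃ 𝒞 : Finset (Finset F × Finset F),
      #𝒞 ≤ ((J + 1) * (Fintype.card F * 2) + 1) ^ (32 * t / #D) *
        (2 ^ (2 * ((4 * kap + 18) * t / #D))) ^ J *
        (Fintype.card F + 1) ^ (3 * ((kap + 4) * t / (ψ + 1))) ∧
      ∀ A : Finset F, tt D A = t → (A + D)ᶜ + D = Aᶜ → #D ≤ 2 * t →
        ∃ c ∈ 𝒞, A ⊆ c.1 ∧ c.2 ⊆ A + D ∧ #(A + D) ≤ #c.2 + 2 * t ∧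
          ee D c.1 c.2ᶜ ≤ 4 * ψ * t := by
  obtain ⟨𝒢, h𝒢c, h𝒢⟩ := multiscale hs hD hN J hJ hJ' t
  let m := (kap + 4) * t / (ψ + 1)
  let sm := (univ : Finset F).powerset.filter (fun Q => #Q ≤ m)
  have hsm : #sm ≤ (Fintype.card F + 1) ^ m := by
    have := card_small (univ : Finset F) m
    rwa [card_univ] at this
  refine ⟨(𝒢 ×ˢ (sm ×ˢ (sm ×ˢ sm))).image (fun q =>
    (dS D ψ q.1 q.2.1 q.2.2.1 q.2.2.2, dW D ψ q.1 q.2.1 q.2.2.1 q.2.2.2)), ?_, ?_⟩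
  · refine card_image_le.trans ?_
    rw [card_product, card_product, card_product]
    apply Nat.mul_le_mul h𝒢c
    have : (Fintype.card F + 1) ^ (3 * m) =
      (Fintype.card F + 1) ^ m * ((Fintype.card F + 1) ^ m * (Fintype.card F + 1) ^ m) := by
      rw [← pow_add, ← pow_add]; congr 1; ring
    rw [this]
    exact Nat.mul_le_mul hsm (Nat.mul_le_mul hsm hsm)
  · intro A htA hdual hdt
    obtain ⟨Gh, hGh, g1, g2⟩ := h𝒢 A htA hdual hdt
    rw [← htA] at g1 g2
    obtain ⟨T1, T2, T3, c1, c2, c3, r1, r2, r3, r4⟩ := passes hs hD ψ (kap + 2) hψ A Gh hdual g1 g2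
    rw [htA] at c1 c2 c3 r3 r4
    have hmem : ∀ T : Finset F, #T * (ψ + 1) ≤ (kap + 4) * t → T ∈ sm := by
      intro T hT
      refine mem_filter.2 ⟨by simp, ?_⟩
      rwa [Nat.le_div_iff_mul_le (by omega)]
    refine ⟨_, mem_image.2 ⟨(Gh, T1, T2, T3), ?_, rfl⟩, r1, r2, r3, r4⟩
    refine mem_product.2 ⟨hGh, mem_product.2 ⟨hmem _ ?_, mem_product.2 ⟨hmem _ ?_, hmem _ ?_⟩⟩⟩
    · refine c1.trans ?_; gcongr; omega
    · refine c2.trans ?_; gcongr; omega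
    · refine c3.trans ?_; gcongr; omega

end greedy
end ACG

namespace ACG
set_option linter.unusedSectionVars false
set_option linter.unusedVariables false
open Finset

section count
variable {F : Type*} [AddCommGroup F] [Fintype F] [DecidableEq F] {D : Finset F}

/-- independent sets inside `V` -/
def inds (D V : Finset F) : Finset (Finset F) :=
  V.powerset.filter (fun I => ∀ x ∈ I, ∀ y ∈ I, y - x ∉ D)

/-- neighbours inside `V` -/
def nb (D I V : Finset F) : Finset F := V.filter (fun y => ∃ x ∈ I, y - x ∈ D)

lemma weighted (hs : ∀ x ∈ D, -x ∈ D) (h0 : (0 : F) ∉ D) (m : ℕ) : ∀ V : Finset F, #V = m →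
    ∑ I ∈ inds D V, (4 / 3 : ℝ) ^ #(nb D I V) ≤ 2 ^ m := by
  induction m using Nat.strong_induction_on with
  | _ m ih =>
  intro V hV
  by_cases hE : ∀ v ∈ V, ∀ w ∈ V, w - v ∉ D
  · have h1 : ∀ I ∈ inds D V, (4 / 3 : ℝ) ^ #(nb D I V) = 1 := by
      intro I hI
      have hIV := mem_powerset.1 (mem_filter.1 hI).1
      have : nb D I V = ∅ := by
        rw [nb, filter_eq_empty_iff]
        rintro y hy ⟨x, hx, hxy⟩
        exact hE x (hIV hx) y hy hxy
      rw [this]; simp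
    rw [sum_congr rfl h1]
    simp only [sum_const, nsmul_eq_mul, mul_one]
    have : #(inds D V) ≤ 2 ^ m := by
      rw [← hV, ← card_powerset]; exact card_filter_le _ _
    exact_mod_cast this
  push Not at hE
  obtain ⟨v, hv, w, hw, hvw⟩ := hE
  set Nv := V.filter (fun y => y - v ∈ D) with hNv
  have hvN : v ∉ Nv := by simp [hNv, h0]
  have hNpos : 1 ≤ #Nv := card_pos.2 ⟨w, mem_filter.2 ⟨hw, hvw⟩⟩
  set V1 := V.erase v with hV1
  set V2 := V1 \ Nv with hV2
  have hNV1 : Nv ⊆ V1 := by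
    intro y hy
    exact mem_erase.2 ⟨fun h => hvN (h ▸ hy), (mem_filter.1 hy).1⟩
  have hV1c : #V1 + 1 = m := by rw [hV1, card_erase_add_one hv, hV]
  have hV2c : #V2 + #Nv = #V1 := card_sdiff_add_card_eq_card hNV1
  have ih1 := ih #V1 (by omega) V1 rfl
  have ih2 := ih #V2 (by omega) V2 rfl
  rw [← sum_filter_add_sum_filter_not (inds D V) (fun I => v ∉ I)]
  have p1 : ∑ I ∈ (inds D V).filter (fun I => v ∉ I), (4 / 3 : ℝ) ^ #(nb D I V) ≤
      (4 / 3) * 2 ^ #V1 := by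
    have hsub : (inds D V).filter (fun I => v ∉ I) ⊆ inds D V1 := by
      intro I hI
      obtain ⟨hI1, hI2⟩ := mem_filter.1 hI
      obtain ⟨hI3, hI4⟩ := mem_filter.1 hI1
      refine mem_filter.2 ⟨mem_powerset.2 (fun x hx => mem_erase.2 ⟨fun h => hI2 (h ▸ hx), mem_powerset.1 hI3 hx⟩), hI4⟩
    calc _ ≤ ∑ I ∈ (inds D V).filter (fun I => v ∉ I), (4 / 3 : ℝ) * (4 / 3 : ℝ) ^ #(nb D I V1) := by
          apply sum_le_sum
          intro I hI
          rw [← pow_succ']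
          apply pow_le_pow_right₀ (by norm_num)
          have : nb D I V ⊆ insert v (nb D I V1) := by
            intro y hy
            obtain ⟨a, b⟩ := mem_filter.1 hy
            by_cases hyv : y = v
            · rw [hyv]; exact mem_insert_self _ _
            · exact mem_insert_of_mem (mem_filter.2 ⟨mem_erase.2 ⟨hyv, a⟩, b⟩)
          exact (card_le_card this).trans (card_insert_le _ _)
      _ ≤ ∑ I ∈ inds D V1, (4 / 3 : ℝ) * (4 / 3 : ℝ) ^ #(nb D I V1) := by
          apply sum_le_sum_of_subset_of_nonneg hsub
          intros; positivity
      _ ≤ _ := by rw [← mul_sum]; gcongr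
  have p2 : ∑ I ∈ (inds D V).filter (fun I => ¬ v ∉ I), (4 / 3 : ℝ) ^ #(nb D I V) ≤
      (4 / 3) ^ #Nv * 2 ^ #V2 := by
    have hinj : Set.InjOn (fun I : Finset F => I.erase v) ((inds D V).filter (fun I => ¬ v ∉ I)) := by
      intro I hI I' hI' h
      have a := (mem_filter.1 (mem_coe.1 hI)).2
      have b := (mem_filter.1 (mem_coe.1 hI')).2
      rw [not_not] at a b
      simp only at h
      rw [← insert_erase a, ← insert_erase b, h]
    have hsub : ((inds D V).filter (fun I => ¬ v ∉ I)).image (fun I => I.erase v) ⊆ inds D V2 := by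
      intro I' hI'
      obtain ⟨I, hI, rfl⟩ := mem_image.1 hI'
      obtain ⟨hI1, hI2⟩ := mem_filter.1 hI
      rw [not_not] at hI2
      obtain ⟨hI3, hI4⟩ := mem_filter.1 hI1
      refine mem_filter.2 ⟨mem_powerset.2 (fun x hx => ?_), fun x hx y hy =>
        hI4 x (mem_of_mem_erase hx) y (mem_of_mem_erase hy)⟩
      obtain ⟨a, b⟩ := mem_erase.1 hx
      refine mem_sdiff.2 ⟨mem_erase.2 ⟨a, mem_powerset.1 hI3 b⟩, fun h => ?_⟩
      exact hI4 v hI2 x b (mem_filter.1 h).2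
    calc _ ≤ ∑ I ∈ (inds D V).filter (fun I => ¬ v ∉ I),
          (4 / 3 : ℝ) ^ #Nv * (4 / 3 : ℝ) ^ #(nb D (I.erase v) V2) := by
          apply sum_le_sum
          intro I hI
          obtain ⟨hI1, hI2⟩ := mem_filter.1 hI
          rw [not_not] at hI2
          obtain ⟨hI3, hI4⟩ := mem_filter.1 hI1
          rw [← pow_add]
          apply pow_le_pow_right₀ (by norm_num)
          have : nb D I V ⊆ Nv ∪ nb D (I.erase v) V2 := by
            intro y hy
            obtain ⟨a, x, hx, hxy⟩ := mem_filter.1 hy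
            by_cases hyN : y ∈ Nv
            · exact mem_union_left _ hyN
            · apply mem_union_right
              refine mem_filter.2 ⟨mem_sdiff.2 ⟨mem_erase.2 ⟨?_, a⟩, hyN⟩, x, mem_erase.2 ⟨?_, hx⟩, hxy⟩
              · rintro rfl; exact hI4 x hx y hI2 hxy
              · rintro rfl; exact hyN (mem_filter.2 ⟨a, hxy⟩)
          exact (card_le_card this).trans (card_union_le _ _)
      _ = ∑ I ∈ ((inds D V).filter (fun I => ¬ v ∉ I)).image (fun I => I.erase v),
          (4 / 3 : ℝ) ^ #Nv * (4 / 3 : ℝ) ^ #(nb D I V2) := by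
          rw [sum_image hinj]
      _ ≤ ∑ I ∈ inds D V2, (4 / 3 : ℝ) ^ #Nv * (4 / 3 : ℝ) ^ #(nb D I V2) := by
          apply sum_le_sum_of_subset_of_nonneg hsub
          intros; positivity
      _ ≤ _ := by rw [← mul_sum]; gcongr
  have p3 : ((4 / 3 : ℝ)) ^ #Nv * 2 ^ #V2 ≤ (2 / 3) * 2 ^ #V1 := by
    rw [← hV2c, pow_add]
    have : ((4 / 3 : ℝ)) ^ #Nv ≤ 2 / 3 * 2 ^ #Nv := by
      obtain ⟨k, hk⟩ : ∃ k, #Nv = k + 1 := ⟨#Nv - 1, by omega⟩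
      rw [hk, pow_succ, pow_succ]
      have : (4 / 3 : ℝ) ^ k ≤ 2 ^ k := by gcongr; norm_num
      linarith
    have h2 : (0 : ℝ) < 2 ^ #V2 := by positivity
    nlinarith
  rw [← hV1c, pow_succ]
  linarith

/-- closure -/
def cl (D I : Finset F) : Finset F := univ.filter (fun x => ∀ δ ∈ D, x + δ ∈ I + D)

lemma sub_cl (I : Finset F) : I ⊆ cl D I := fun x hx =>
  mem_filter.2 ⟨mem_univ _, fun δ hδ => add_mem_add hx hδ⟩

lemma cl_add (I : Finset F) : cl D I + D = I + D := by
  apply Subset.antisymm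
  · intro y hy
    obtain ⟨x, hx, δ, hδ, rfl⟩ := mem_add.1 hy
    exact (mem_filter.1 hx).2 δ hδ
  · exact add_subset_add_right (sub_cl I)

lemma cl_dual (hs : ∀ x ∈ D, -x ∈ D) (I : Finset F) : (cl D I + D)ᶜ + D = (cl D I)ᶜ := by
  rw [cl_add]
  ext x
  rw [mem_thick, mem_compl, cl, mem_filter]
  simp only [mem_univ, true_and, mem_compl]
  push Not
  constructor
  · rintro ⟨p, hp, h⟩
    exact ⟨p - x, D_sub_comm hs h, by simpa using hp⟩
  · rintro ⟨δ, hδ, h⟩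
    exact ⟨x + δ, h, by simpa using hs δ hδ⟩

lemma card_small_real {α : Type*} [DecidableEq α] (X : Finset α) (k : ℕ) (x : ℝ) (hx : 0 < x)
    (hx1 : x ≤ 1) : (#(X.powerset.filter (fun Q => #Q ≤ k)) : ℝ) ≤ (1 / x) ^ k * (1 + x) ^ #X := by
  have h1 : ∑ Q ∈ X.powerset, x ^ #Q = (1 + x) ^ #X := by
    have := Finset.prod_one_add (R := ℝ) (f := fun _ => x) X
    simp only [prod_const] at this
    rw [this]
  have h2 : (#(X.powerset.filter (fun Q => #Q ≤ k)) : ℝ) * x ^ k ≤ ∑ Q ∈ X.powerset, x ^ #Q := by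
    rw [← nsmul_eq_mul, ← sum_const]
    refine (sum_le_sum (g := fun Q => x ^ #Q) ?_).trans
      (sum_le_sum_of_subset_of_nonneg (filter_subset _ _) (fun _ _ _ => by positivity))
    intro Q hQ
    exact pow_le_pow_of_le_one hx.le hx1 (mem_filter.1 hQ).2
  rw [h1] at h2
  rw [one_div, inv_pow, inv_mul_eq_div, le_div_iff₀ (by positivity)]
  exact h2

end count
end ACG

namespace ACG
set_option linter.unusedSectionVars false
set_option linter.unusedVariables false
open Finset

section count2
variable {F : Type*} [AddCommGroup F] [Fintype F] [DecidableEq F] {D : Finset F}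

lemma two_pow_le {a : ℕ} {x : ℝ} (h : (a : ℝ) ≤ x) : (2 : ℝ) ^ a ≤ (2 : ℝ) ^ x := by
  rw [← Real.rpow_natCast]
  exact Real.rpow_le_rpow_of_exponent_le (by norm_num) h

/-- case 1: `G \ W` is small -/
lemma count1 (hs : ∀ x ∈ D, -x ∈ D) (hD : D.Nonempty) {n : ℕ}
    (hN : Fintype.card F = 2 * n) {l t : ℕ} (hl : 1 ≤ l) (hl2 : 64 * #D ≤ 2 ^ l) (S W : Finset F)
    (hX : #((S + D) \ W) ≤ 2 * #D * t) :
    (#((inds D univ).filter (fun I => tt D (cl D I) = t ∧ cl D I ⊆ S ∧ W ⊆ I + D ∧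
      #((I + D) \ W) ≤ t / (8 * l))) : ℝ) ≤ (2 : ℝ) ^ ((n : ℝ) - t / (50 * l)) := by
  have hd : 0 < #D := card_pos.2 hD
  set X := (S + D) \ W with hXdef
  set k := t / (8 * l) with hk
  let AQ : Finset F → Finset F := fun Q => (univ.filter (fun x => ∀ δ ∈ D, x + δ ∈ W ∪ Q)) \ (W ∪ Q)
  let 𝒬 := X.powerset.filter (fun Q => #Q ≤ k)
  have hsub : (inds D univ).filter (fun I => tt D (cl D I) = t ∧ cl D I ⊆ S ∧ W ⊆ I + D ∧
      #((I + D) \ W) ≤ k) ⊆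
      𝒬.biUnion (fun Q => if 2 * #(AQ Q) + t ≤ 2 * n then (AQ Q).powerset else ∅) := by
    intro I hI
    obtain ⟨hI1, ht, hS, hW, hc⟩ := mem_filter.1 hI
    have hind := (mem_filter.1 hI1).2
    have hWQ : W ∪ ((I + D) \ W) = I + D := union_sdiff_of_subset hW
    have hAQ : AQ ((I + D) \ W) = cl D I \ (I + D) := by
      simp only [AQ, hWQ]; rfl
    refine mem_biUnion.2 ⟨(I + D) \ W, mem_filter.2 ⟨mem_powerset.2 ?_, hc⟩, ?_⟩
    · apply sdiff_subset_sdiff _ (le_refl _)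
      exact add_subset_add_right ((sub_cl I).trans hS)
    · rw [hAQ]
      have c1 : #(cl D I \ (I + D)) ≤ #(cl D I) := card_le_card sdiff_subset
      have c2 : #(cl D I \ (I + D)) + #(I + D) ≤ 2 * n := by
        rw [← hN, card_sdiff_add_card]; exact card_le_univ _
      have c3 := tt_add hD (cl D I)
      rw [cl_add, ht] at c3
      rw [if_pos (by omega), mem_powerset]
      intro x hx
      refine mem_sdiff.2 ⟨sub_cl I hx, fun h => ?_⟩
      obtain ⟨p, hp, hxp⟩ := mem_thick.1 h
      exact hind p hp x hx hxp
  have hb : ∀ Q ∈ 𝒬, (#(if 2 * #(AQ Q) + t ≤ 2 * n then (AQ Q).powerset else ∅) : ℝ) ≤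
      (2 : ℝ) ^ ((n : ℝ) - t / 2) := by
    intro Q _
    split_ifs with h
    · rw [card_powerset]
      push_cast
      apply two_pow_le
      have : (2 * (#(AQ Q) : ℝ) + t) ≤ 2 * n := by exact_mod_cast h
      linarith
    · simp; positivity
  have h1 : (#((inds D univ).filter (fun I => tt D (cl D I) = t ∧ cl D I ⊆ S ∧ W ⊆ I + D ∧
      #((I + D) \ W) ≤ k)) : ℝ) ≤ #𝒬 * (2 : ℝ) ^ ((n : ℝ) - t / 2) := by
    calc _ ≤ (#(𝒬.biUnion (fun Q => if 2 * #(AQ Q) + t ≤ 2 * n then (AQ Q).powerset else ∅)) : ℝ) := by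
          exact_mod_cast card_le_card hsub
      _ ≤ ∑ Q ∈ 𝒬, (#(if 2 * #(AQ Q) + t ≤ 2 * n then (AQ Q).powerset else ∅) : ℝ) := by
          exact_mod_cast card_biUnion_le
      _ ≤ ∑ Q ∈ 𝒬, (2 : ℝ) ^ ((n : ℝ) - t / 2) := sum_le_sum hb
      _ = _ := by simp
  have hd' : (0 : ℝ) < #D := by exact_mod_cast hd
  have hl' : (1 : ℝ) ≤ l := by exact_mod_cast hl
  have h2 : (#𝒬 : ℝ) ≤ (2 : ℝ) ^ ((t : ℝ) / 8 + t / 16) := by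
    refine (card_small_real X k (1 / (64 * #D)) (by positivity) ?_).trans ?_
    · rw [div_le_one (by positivity)]
      have : (1 : ℝ) ≤ #D := by exact_mod_cast hd
      linarith
    · rw [Real.rpow_add (by norm_num)]
      apply mul_le_mul _ _ (by positivity) (by positivity)
      · rw [one_div_one_div]
        have : (64 * (#D : ℝ)) ≤ 2 ^ l := by exact_mod_cast hl2
        calc (64 * (#D : ℝ)) ^ k ≤ ((2 : ℝ) ^ l) ^ k := by gcongr
          _ = (2 : ℝ) ^ (l * k) := by rw [← pow_mul]
          _ ≤ _ := by
            apply two_pow_le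
            have : k * (8 * l) ≤ t := Nat.div_mul_le_self _ _
            have : (k : ℝ) * (8 * l) ≤ t := by exact_mod_cast this
            push_cast; linarith
      · calc (1 + 1 / (64 * (#D : ℝ))) ^ #X ≤ (Real.exp (1 / (64 * #D))) ^ #X := by
              gcongr
              have := Real.add_one_le_exp (1 / (64 * (#D : ℝ))); linarith
          _ = Real.exp (#X * (1 / (64 * #D))) := by rw [Real.exp_nat_mul]
          _ ≤ Real.exp (Real.log 2 * (t / 16)) := by
              apply Real.exp_le_exp.2
              have h3 : (#X : ℝ) ≤ 2 * #D * t := by exact_mod_cast hX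
              have h4 : (#X : ℝ) * (1 / (64 * #D)) ≤ t / 32 := by
                rw [mul_one_div, div_le_iff₀ (by positivity)]
                linarith
              have h5 := Real.log_two_gt_d9
              have h6 : (0 : ℝ) ≤ t := by positivity
              nlinarith
          _ = _ := by rw [Real.rpow_def_of_pos (by norm_num)]
  refine h1.trans ?_
  calc _ ≤ (2 : ℝ) ^ ((t : ℝ) / 8 + t / 16) * (2 : ℝ) ^ ((n : ℝ) - t / 2) := by gcongr
    _ = (2 : ℝ) ^ ((t : ℝ) / 8 + t / 16 + ((n : ℝ) - t / 2)) := by rw [← Real.rpow_add (by norm_num)]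
    _ ≤ _ := by
      apply Real.rpow_le_rpow_of_exponent_le (by norm_num)
      have : (t : ℝ) / (50 * l) ≤ t / 4 := by
        apply div_le_div_of_nonneg_left (by positivity) (by norm_num) (by linarith)
      linarith [(by positivity : (0 : ℝ) ≤ t)]

/-- case 2 -/
lemma count2 (hs : ∀ x ∈ D, -x ∈ D) (hD : D.Nonempty) (h0 : (0 : F) ∉ D) {n : ℕ}
    (hN : Fintype.card F = 2 * n) {l t ψ : ℕ} (hl : 1 ≤ l) (hψ : ψ * (400 * l) ≤ #D)
    (S W : Finset F) (hee : ee D S Wᶜ ≤ 4 * ψ * t) :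
    (#((inds D univ).filter (fun I => cl D I ⊆ S ∧ W ⊆ I + D ∧
      t / (8 * l) < #((I + D) \ W))) : ℝ) ≤ (2 : ℝ) ^ ((n : ℝ) - t / (50 * l)) := by
  have hd : 0 < #D := card_pos.2 hD
  have hd' : (0 : ℝ) < #D := by exact_mod_cast hd
  have hl' : (1 : ℝ) ≤ l := by exact_mod_cast hl
  set V := S \ W with hV
  set m' := #(S ∪ W)ᶜ with hm'
  have e1 : #S * #D ≤ #W * #D + 4 * ψ * t := by
    have a := ee_compl (D := D) S W
    have b := ee_le (D := D) W S
    rw [ee_comm hs] at b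
    omega
  have e2 : #V + #W + m' = 2 * n := by
    rw [hV, card_sdiff_add_card, hm', ← hN, add_comm, card_compl_add_card]
  have e3 : #V ≤ #S := card_le_card sdiff_subset
  have hψ' : (ψ : ℝ) * (400 * l) ≤ #D := by exact_mod_cast hψ
  have hVr : 2 * (#V : ℝ) + m' ≤ 2 * n + t / (100 * l) := by
    have a : (#S : ℝ) * #D ≤ #W * #D + 4 * ψ * t := by exact_mod_cast e1
    have b : (#V : ℝ) + #W + m' = 2 * n := by exact_mod_cast e2
    have c : (#V : ℝ) ≤ #S := by exact_mod_cast e3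
    have a2 : (#S : ℝ) ≤ #W + t / (100 * l) := by
      have : (4 : ℝ) * ψ * t ≤ t / (100 * l) * #D := by
        rw [div_mul_eq_mul_div, le_div_iff₀ (by positivity)]
        have : (0 : ℝ) ≤ t := by positivity
        nlinarith
      have : (#S : ℝ) * #D ≤ (#W + t / (100 * l)) * #D := by linarith
      exact le_of_mul_le_mul_right this hd'
    linarith
  have hIV : ∀ I ∈ (inds D univ).filter (fun I => cl D I ⊆ S ∧ W ⊆ I + D ∧
      t / (8 * l) < #((I + D) \ W)), I ∈ inds D V := by
    intro I hI
    obtain ⟨hI1, hS, hW, hc⟩ := mem_filter.1 hI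
    have hind := (mem_filter.1 hI1).2
    refine mem_filter.2 ⟨mem_powerset.2 (fun x hx => ?_), hind⟩
    refine mem_sdiff.2 ⟨hS (sub_cl I hx), fun h => ?_⟩
    obtain ⟨p, hp, hxp⟩ := mem_thick.1 (hW h)
    exact hind p hp x hx hxp
  have q : (t : ℝ) / (100 * l) = (t / l) / 100 := by field_simp
  have q2 : (t : ℝ) / (50 * l) = (t / l) / 50 := by field_simp
  have q0 : (0 : ℝ) ≤ t / l := by positivity
  by_cases hm : t ≤ 16 * l * m'
  · have h1 : (#((inds D univ).filter (fun I => cl D I ⊆ S ∧ W ⊆ I + D ∧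
      t / (8 * l) < #((I + D) \ W))) : ℝ) ≤ (2 : ℝ) ^ #V := by
      have : #((inds D univ).filter (fun I => cl D I ⊆ S ∧ W ⊆ I + D ∧
        t / (8 * l) < #((I + D) \ W))) ≤ 2 ^ #V := by
        rw [← card_powerset]
        apply card_le_card
        intro I hI
        exact (mem_filter.1 (hIV I hI)).1
      exact_mod_cast this
    refine h1.trans (two_pow_le ?_)
    have hm2 : (t : ℝ) / l ≤ 16 * m' := by
      rw [div_le_iff₀ (by positivity)]
      have : (t : ℝ) ≤ 16 * l * m' := by exact_mod_cast hm
      linarith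
    rw [q] at hVr; rw [q2]
    linarith
  · have hw := weighted hs h0 #V V rfl
    have hnb : ∀ I ∈ (inds D univ).filter (fun I => cl D I ⊆ S ∧ W ⊆ I + D ∧
      t / (8 * l) < #((I + D) \ W)), (2 : ℝ) ^ ((t : ℝ) / l / 40) ≤ (4 / 3 : ℝ) ^ #(nb D I V) := by
      intro I hI
      obtain ⟨hI1, hS, hW, hc⟩ := mem_filter.1 hI
      have c1 : (I + D) \ W ⊆ (S ∪ W)ᶜ ∪ nb D I V := by
        intro y hy
        obtain ⟨a, b⟩ := mem_sdiff.1 hy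
        by_cases hyS : y ∈ S
        · apply mem_union_right
          exact mem_filter.2 ⟨mem_sdiff.2 ⟨hyS, b⟩, mem_thick.1 a⟩
        · apply mem_union_left
          rw [mem_compl, mem_union, not_or]; exact ⟨hyS, b⟩
      have c2 := (card_le_card c1).trans (card_union_le _ _)
      have c3 : t < (m' + #(nb D I V)) * (8 * l) := by
        have : t < #((I + D) \ W) * (8 * l) := (Nat.div_lt_iff_lt_mul (by omega)).1 hc
        exact this.trans_le (Nat.mul_le_mul_right _ c2)
      have c4 : t < 16 * l * #(nb D I V) := by
        push Not at hm
        nlinarith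
      have c5 : (t : ℝ) / l ≤ 16 * #(nb D I V) := by
        rw [div_le_iff₀ (by positivity)]
        have : (t : ℝ) ≤ 16 * l * #(nb D I V) := by exact_mod_cast c4.le
        linarith
      have c6 : (2 : ℝ) ^ (2 / 5 : ℝ) ≤ 4 / 3 := by
        have : (2 : ℝ) ^ (2 / 5 : ℝ) = ((4 : ℝ)) ^ ((1 : ℝ) / 5) := by
          rw [show (4 : ℝ) = 2 ^ (2 : ℝ) by norm_num, ← Real.rpow_mul (by norm_num)]
          norm_num
        rw [this, ← Real.rpow_le_rpow_iff (z := 5) (by positivity) (by norm_num) (by norm_num),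
          ← Real.rpow_mul (by norm_num)]
        norm_num
      calc (2 : ℝ) ^ ((t : ℝ) / l / 40) ≤ (2 : ℝ) ^ ((2 / 5 : ℝ) * #(nb D I V)) := by
            apply Real.rpow_le_rpow_of_exponent_le (by norm_num); linarith
        _ = ((2 : ℝ) ^ (2 / 5 : ℝ)) ^ #(nb D I V) := by
            rw [Real.rpow_mul (by norm_num), Real.rpow_natCast]
        _ ≤ _ := by gcongr
    set K := (inds D univ).filter (fun I => cl D I ⊆ S ∧ W ⊆ I + D ∧
      t / (8 * l) < #((I + D) \ W)) with hK
    have h3 : (#K : ℝ) * (2 : ℝ) ^ ((t : ℝ) / l / 40) ≤ 2 ^ #V := by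
      calc (#K : ℝ) * (2 : ℝ) ^ ((t : ℝ) / l / 40) = ∑ I ∈ K, (2 : ℝ) ^ ((t : ℝ) / l / 40) := by simp
        _ ≤ ∑ I ∈ K, (4 / 3 : ℝ) ^ #(nb D I V) := sum_le_sum hnb
        _ ≤ ∑ I ∈ inds D V, (4 / 3 : ℝ) ^ #(nb D I V) := by
            apply sum_le_sum_of_subset_of_nonneg hIV
            intros; positivity
        _ ≤ _ := hw
    have h4 : (2 : ℝ) ^ #V ≤ (2 : ℝ) ^ ((n : ℝ) + t / l / 200) := by
      apply two_pow_le
      have : (0 : ℝ) ≤ m' := by positivity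
      rw [q] at hVr; linarith
    have h5 : (2 : ℝ) ^ ((n : ℝ) + t / l / 200) =
        (2 : ℝ) ^ ((n : ℝ) - t / (50 * l)) * (2 : ℝ) ^ ((t : ℝ) / l / 40) := by
      rw [← Real.rpow_add (by norm_num), q2]; congr 1; ring
    have h6 := (h3.trans h4).trans_eq h5
    exact le_of_mul_le_mul_right h6 (by positivity)

/-- independent sets with given container -/
lemma count_container (hs : ∀ x ∈ D, -x ∈ D) (hD : D.Nonempty) (h0 : (0 : F) ∉ D) {n : ℕ}
    (hN : Fintype.card F = 2 * n) {l t ψ : ℕ} (hl : 1 ≤ l) (hl2 : 64 * #D ≤ 2 ^ l)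
    (hψ : ψ * (400 * l) ≤ #D) (S W : Finset F) (hee : ee D S Wᶜ ≤ 4 * ψ * t) :
    (#((inds D univ).filter (fun I => tt D (cl D I) = t ∧ cl D I ⊆ S ∧ W ⊆ I + D)) : ℝ) ≤
      2 * (2 : ℝ) ^ ((n : ℝ) - t / (50 * l)) := by
  have hX : #((S + D) \ W) ≤ 2 * #D * t := by
    have h1 : #((S + D) \ W) ≤ ee D ((S + D) \ W) S := by
      unfold ee
      rw [card_eq_sum_ones]
      apply sum_le_sum
      intro y hy
      obtain ⟨x, hx, hyx⟩ := mem_thick.1 (mem_sdiff.1 hy).1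
      exact card_pos.2 ⟨x, mem_filter.2 ⟨hx, D_sub_comm hs hyx⟩⟩
    have h2 : ee D ((S + D) \ W) S ≤ ee D Wᶜ S :=
      ee_mono (fun y hy => mem_compl.2 (mem_sdiff.1 hy).2) (le_refl _)
    rw [ee_comm hs Wᶜ] at h2
    have h3 : 2 * ψ ≤ #D := by nlinarith
    have h4 : 4 * ψ * t ≤ 2 * #D * t := Nat.mul_le_mul_right _ (by omega)
    omega
  have c1 := count1 hs hD hN hl hl2 S W hX
  have c2 := count2 hs hD h0 hN hl hψ S W hee
  have hsub : (inds D univ).filter (fun I => tt D (cl D I) = t ∧ cl D I ⊆ S ∧ W ⊆ I + D) ⊆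
      ((inds D univ).filter (fun I => tt D (cl D I) = t ∧ cl D I ⊆ S ∧ W ⊆ I + D ∧
      #((I + D) \ W) ≤ t / (8 * l))) ∪ ((inds D univ).filter (fun I => cl D I ⊆ S ∧ W ⊆ I + D ∧
      t / (8 * l) < #((I + D) \ W))) := by
    intro I hI
    obtain ⟨a, b, c, d⟩ := mem_filter.1 hI
    by_cases h : #((I + D) \ W) ≤ t / (8 * l)
    · exact mem_union_left _ (mem_filter.2 ⟨a, b, c, d, h⟩)
    · exact mem_union_right _ (mem_filter.2 ⟨a, c, d, not_le.1 h⟩)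
  have h1 : (#((inds D univ).filter (fun I => tt D (cl D I) = t ∧ cl D I ⊆ S ∧ W ⊆ I + D)) : ℝ) ≤
      _ := Nat.cast_le.2 ((card_le_card hsub).trans (card_union_le _ _))
  push_cast at h1
  linarith

end count2
end ACG

namespace ACG
set_option linter.unusedSectionVars false
set_option linter.unusedVariables false
open Finset

section total
variable {F : Type*} [AddCommGroup F] [Fintype F] [DecidableEq F] {D : Finset F}

lemma two_cosets (hs : ∀ x ∈ D, -x ∈ D) (hgen : AddSubgroup.closure (D : Set F) = ⊤) {e : F}
    (he : e ∈ D) (x : F) : x ∈ HH D ∨ x - e ∈ HH D := by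
  have hee : e + e ∈ HH D := by
    apply AddSubgroup.subset_closure; exact_mod_cast add_mem_add he he
  have hx : x ∈ AddSubgroup.closure (D : Set F) := by rw [hgen]; trivial
  induction hx using AddSubgroup.closure_induction with
  | mem y hy => exact Or.inr (D_diff hs (by exact_mod_cast hy) he)
  | zero => exact Or.inl (zero_mem _)
  | add y z _ _ hy hz =>
    rcases hy with hy | hy <;> rcases hz with hz | hz
    · exact Or.inl (add_mem hy hz)
    · right; convert add_mem hy hz using 1; abel
    · right; convert add_mem hy hz using 1; abel
    · left; convert add_mem (add_mem hy hz) hee using 1; abel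
  | neg y _ hy =>
    rcases hy with hy | hy
    · exact Or.inl (neg_mem hy)
    · right; convert neg_mem (add_mem hy hee) using 1; abel

lemma cosetF_two (hs : ∀ x ∈ D, -x ∈ D) (hgen : AddSubgroup.closure (D : Set F) = ⊤) {e : F}
    (he : e ∈ D) (x : F) : cosetF D x = cosetF D 0 ∨ cosetF D x = cosetF D e := by
  rcases two_cosets hs hgen he x with h | h
  · left; ext y; rw [mem_cosetF, mem_cosetF]
    constructor
    · intro hy; convert add_mem hy h using 1; abel
    · intro hy; convert sub_mem hy h using 1; abel
  · right; ext y; rw [mem_cosetF, mem_cosetF]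
    constructor
    · intro hy; convert add_mem hy h using 1; abel
    · intro hy; convert sub_mem hy h using 1; abel

lemma card_le_two_hh (hs : ∀ x ∈ D, -x ∈ D) (hD : D.Nonempty)
    (hgen : AddSubgroup.closure (D : Set F) = ⊤) : Fintype.card F ≤ 2 * hh D := by
  obtain ⟨e, he⟩ := hD
  have : (univ : Finset F) ⊆ cosetF D 0 ∪ cosetF D e := by
    intro x _
    rw [mem_union, mem_cosetF, mem_cosetF, sub_zero]
    exact two_cosets hs hgen he x
  have h1 := (card_le_card this).trans (card_union_le _ _)
  rw [card_cosetF, card_cosetF, card_univ] at h1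
  omega

lemma exists_J (hs : ∀ x ∈ D, -x ∈ D) (hD : D.Nonempty) {n : ℕ}
    (hN : Fintype.card F = 2 * n) (hn : 1 ≤ n) :
    ∃ J, hh D ≤ #(bl D (2 ^ J)) ∧ (∀ j < J, #(bl D (2 ^ j)) < hh D) ∧ 2 ^ J ≤ 8 * n := by
  classical
  have hd : 1 ≤ #D := card_pos.2 hD
  have hle : ∀ P : Finset F, #P ≤ 2 * n := fun P => by rw [← hN]; exact card_le_univ P
  have key : ∀ j, #(bl D (2 ^ j)) < hh D → 2 ^ j ≤ 4 * n := by
    intro j hj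
    rcases bl_grow hs hD (2 ^ j) with h | h
    · omega
    · have := hle (bl D (2 ^ j))
      have : 2 ^ j * 1 ≤ 2 ^ j * #D := Nat.mul_le_mul_left _ hd
      omega
  have hex : ∃ j, hh D ≤ #(bl D (2 ^ j)) := by
    refine ⟨4 * n, ?_⟩
    by_contra h
    have := key _ (not_le.1 h)
    have := Nat.lt_two_pow_self (n := 4 * n)
    omega
  refine ⟨Nat.find hex, Nat.find_spec hex, fun j hj => not_le.1 (Nat.find_min hex hj), ?_⟩
  rcases h : Nat.find hex with _ | j
  · omega
  · have := key j (not_le.1 (Nat.find_min hex (by omega)))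
    rw [pow_succ]; omega

/-- the container count -/
def cnt (N J d t ψ : ℕ) : ℕ := ((J+1)*(N*2)+1)^(32*t/d) * (2^(2*((4*kap+18)*t/d)))^J *
  (N+1)^(3*((kap+4)*t/(ψ+1)))

lemma count_t (hs : ∀ x ∈ D, -x ∈ D) (hD : D.Nonempty) (h0 : (0 : F) ∉ D) {n : ℕ}
    (hgen : AddSubgroup.closure (D : Set F) = ⊤)
    (hN : Fintype.card F = 2 * n) {l t J ψ : ℕ} (hl : 1 ≤ l) (hl2 : 64 * #D ≤ 2 ^ l)
    (hψ : ψ * (400 * l) ≤ #D) (hJ : hh D ≤ #(bl D (2^J))) (hJ' : ∀ j<J, #(bl D (2^j)) < hh D)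
    (ht : #D ≤ 2 * t) :
    (#((inds D univ).filter (fun I => tt D (cl D I) = t)) : ℝ) ≤
      cnt (2 * n) J #D t ψ * (2*(2:ℝ)^((n:ℝ) - t/(50*l))) := by
  classical
  have hψ2 : 2 * ψ ≤ #D := by
    have : ψ * 2 ≤ ψ * (400 * l) := Nat.mul_le_mul_left _ (by omega)
    omega
  obtain ⟨𝒞, hc, h⟩ := containers hs hD (card_le_two_hh hs hD hgen) J hJ hJ' t ψ hψ2
  rw [hN] at hc
  have hsub : (inds D univ).filter (fun I => tt D (cl D I) = t) ⊆
      (𝒞.filter (fun c => ee D c.1 c.2ᶜ ≤ 4*ψ*t)).biUnion (fun c => (inds D univ).filter (fun I => tt D (cl D I) = t ∧ cl D I ⊆ c.1 ∧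
        c.2 ⊆ I + D)) := by
    intro I hI
    obtain ⟨hI1, hI2⟩ := mem_filter.1 hI
    obtain ⟨c, hc, h1, h2, h3, h4⟩ := h (cl D I) hI2 (cl_dual hs I) ht
    rw [cl_add] at h2
    exact mem_biUnion.2 ⟨c, mem_filter.2 ⟨hc, h4⟩, mem_filter.2 ⟨hI1, hI2, h1, h2⟩⟩
  have h1 := (card_le_card hsub).trans card_biUnion_le
  have hpos : (0:ℝ) ≤ 2*(2:ℝ)^((n:ℝ) - t/(50*l)) := by positivity
  calc (#((inds D univ).filter (fun I => tt D (cl D I) = t)) : ℝ) ≤ _ := Nat.cast_le.2 h1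
    _ = ∑ c ∈ 𝒞.filter (fun c => ee D c.1 c.2ᶜ ≤ 4*ψ*t), (#((inds D univ).filter (fun I => tt D (cl D I) = t ∧ cl D I ⊆ c.1 ∧
        c.2 ⊆ I + D)) : ℝ) := by push_cast; rfl
    _ ≤ ∑ c ∈ 𝒞.filter (fun c => ee D c.1 c.2ᶜ ≤ 4*ψ*t), (2*(2:ℝ)^((n:ℝ) - t/(50*l))) := by
        apply sum_le_sum
        intro c hc
        exact count_container hs hD h0 hN hl hl2 hψ c.1 c.2 (mem_filter.1 hc).2
    _ = (#(𝒞.filter (fun c => ee D c.1 c.2ᶜ ≤ 4*ψ*t)) : ℝ) * (2*(2:ℝ)^((n:ℝ) - t/(50*l))) := by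
        rw [sum_const, nsmul_eq_mul]
    _ ≤ _ := by
        apply mul_le_mul_of_nonneg_right _ hpos
        exact_mod_cast (card_filter_le _ _).trans hc

lemma count_total (hs : ∀ x ∈ D, -x ∈ D) (hD : D.Nonempty) (h0 : (0 : F) ∉ D) {n : ℕ}
    (hgen : AddSubgroup.closure (D : Set F) = ⊤)
    (hN : Fintype.card F = 2 * n) {l J ψ : ℕ} (hl : 1 ≤ l) (hl2 : 64 * #D ≤ 2 ^ l)
    (hψ : ψ * (400 * l) ≤ #D) (hJ : hh D ≤ #(bl D (2^J))) (hJ' : ∀ j<J, #(bl D (2^j)) < hh D)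
    (B : ℝ) (hB0 : 0 ≤ B) (hB : ∀ t, #D ≤ 2 * t →
      cnt (2 * n) J #D t ψ * (2*(2:ℝ)^((n:ℝ) - t/(50*l))) ≤ B) :
    (#(inds D univ) : ℝ) ≤ 2 ^ (n + 1) + (2 * n + 1) * B := by
  classical
  obtain ⟨e, he⟩ := hD
  have hD : D.Nonempty := ⟨e, he⟩
  have hh2 := card_le_two_hh hs hD hgen
  have hsub : inds D univ ⊆ ((cosetF D 0)ᶜ.powerset ∪ (cosetF D e)ᶜ.powerset) ∪
      ((range (2 * n + 1)).filter (fun t => #D ≤ 2 * t)).biUnion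
        (fun t => (inds D univ).filter (fun I => tt D (cl D I) = t)) := by
    intro I hI
    by_cases hex : ∃ x, Disjoint I (cosetF D x)
    · obtain ⟨x, hx⟩ := hex
      apply mem_union_left
      rw [mem_union, mem_powerset, mem_powerset, ← le_iff_subset, ← le_iff_subset,
        le_compl_iff_disjoint_right, le_compl_iff_disjoint_right]
      rcases cosetF_two hs hgen he x with h | h
      · left; rwa [h] at hx
      · right; rwa [h] at hx
    · push Not at hex
      apply mem_union_right
      have hind := (mem_filter.1 hI).2
      have hne : I.Nonempty := by
        rw [nonempty_iff_ne_empty]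
        rintro rfl
        exact hex 0 (disjoint_empty_left _)
      have hfull : ∀ x, ¬ cosetF D x ⊆ cl D I + D := by
        intro x hx
        rw [cl_add] at hx
        apply hex x
        rw [disjoint_left]
        intro y hy hy'
        obtain ⟨z, hz, δ, hδ, h⟩ := mem_add.1 (hx hy')
        apply hind z hz y hy
        rw [← h]; simpa using hδ
      have h1 := iso_gen hs hD (cl D I) (hne.mono (sub_cl I)) hfull
      have h2 := tt_add hD (cl D I)
      have h3 : #(cl D I + D) ≤ 2 * n := by rw [← hN]; exact card_le_univ _
      refine mem_biUnion.2 ⟨tt D (cl D I), mem_filter.2 ⟨mem_range.2 (by omega), by omega⟩,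
        mem_filter.2 ⟨hI, rfl⟩⟩
  have h1 := (card_le_card hsub).trans (card_union_le _ _)
  have h2 : #((cosetF D 0)ᶜ.powerset ∪ (cosetF D e)ᶜ.powerset) ≤ 2 ^ (n + 1) := by
    refine (card_union_le _ _).trans ?_
    rw [card_powerset, card_powerset, card_compl, card_compl, card_cosetF, card_cosetF, hN]
    have : 2 ^ (2 * n - hh D) ≤ 2 ^ n := Nat.pow_le_pow_right (by norm_num) (by omega)
    rw [pow_succ]; omega
  have h3 : ((#(((range (2 * n + 1)).filter (fun t => #D ≤ 2 * t)).biUnion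
        (fun t => (inds D univ).filter (fun I => tt D (cl D I) = t))) : ℕ) : ℝ) ≤ (2 * n + 1) * B := by
    calc _ ≤ ((∑ t ∈ (range (2 * n + 1)).filter (fun t => #D ≤ 2 * t),
          #((inds D univ).filter (fun I => tt D (cl D I) = t)) : ℕ) : ℝ) := Nat.cast_le.2 card_biUnion_le
      _ = ∑ t ∈ (range (2 * n + 1)).filter (fun t => #D ≤ 2 * t),
          (#((inds D univ).filter (fun I => tt D (cl D I) = t)) : ℝ) := by push_cast; rfl
      _ ≤ ∑ t ∈ (range (2 * n + 1)).filter (fun t => #D ≤ 2 * t), B := by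
          apply sum_le_sum
          intro t ht
          have ht := (mem_filter.1 ht).2
          exact (count_t hs hD h0 hgen hN hl hl2 hψ hJ hJ' ht).trans (hB t ht)
      _ = #((range (2 * n + 1)).filter (fun t => #D ≤ 2 * t)) * B := by rw [sum_const, nsmul_eq_mul]
      _ ≤ (2 * n + 1) * B := by
          apply mul_le_mul_of_nonneg_right _ hB0
          have := card_filter_le (range (2 * n + 1)) (fun t => #D ≤ 2 * t)
          rw [card_range] at this
          exact_mod_cast this
  have h4 : (#(inds D univ) : ℝ) ≤ _ := Nat.cast_le.2 h1
  refine h4.trans ?_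
  push_cast
  have h2' : ((#((cosetF D 0)ᶜ.powerset ∪ (cosetF D e)ᶜ.powerset) : ℕ) : ℝ) ≤ 2 ^ (n + 1) := by
    exact_mod_cast h2
  linarith

end total
end ACG

namespace ACG
set_option linter.unusedSectionVars false
set_option linter.unusedVariables false
open Finset

lemma cnt_le {n J d t l : ℕ} (hn : 33 ≤ n) (hJ : 2 ^ J ≤ 8 * n) (hd : 1 ≤ d) (hl : 1 ≤ l) :
    (cnt (2 * n) J d t (d / (400 * l)) : ℝ) ≤
      (2 : ℝ) ^ (logb 2 n * ((10 ^ 4 * kap : ℝ) * l * t / d)) := by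
  set ψ := d / (400 * l) with hψ
  have hJ1 : J < 2 ^ J := Nat.lt_two_pow_self
  have b1 : (J+1)*(2*n*2)+1 ≤ n ^ 3 := by
    have : (J + 1) * (2*n*2) ≤ (8 * n) * (2 * n * 2) := Nat.mul_le_mul_right _ (by omega)
    nlinarith [Nat.mul_le_mul_right (n * n) hn]
  have b2 : 2 ^ J ≤ n ^ 2 := by nlinarith
  have b3 : 2 * n + 1 ≤ n ^ 2 := by nlinarith
  set E := 3 * (32*t/d) + 2 * (2*((4*kap+18)*t/d)) + 2 * (3*((kap+4)*t/(ψ+1))) with hE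
  have h1 : cnt (2 * n) J d t ψ ≤ n ^ E := by
    rw [cnt, hE, pow_add, pow_add, pow_mul n 3, pow_mul n 2, pow_mul n 2, ← pow_mul 2 _ J,
      mul_comm _ J, pow_mul 2 J]
    gcongr
  have hdR : (0:ℝ) < d := by exact_mod_cast hd
  have hlR : (1:ℝ) ≤ l := by exact_mod_cast hl
  have hk : (1:ℝ) ≤ kap := by unfold kap; norm_num
  have htR : (0:ℝ) ≤ t := by positivity
  have q1 : ((32*t/d : ℕ) : ℝ) ≤ 32 * (t / d) := by
    refine Nat.cast_div_le.trans (le_of_eq ?_); push_cast; ring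
  have q2 : (((4*kap+18)*t/d : ℕ) : ℝ) ≤ (4*kap+18) * (t / d) := by
    refine Nat.cast_div_le.trans (le_of_eq ?_); push_cast; ring
  have q3 : (((kap+4)*t/(ψ+1) : ℕ) : ℝ) ≤ (kap+4) * (400 * l * (t / d)) := by
    refine Nat.cast_div_le.trans ?_
    have hp : d ≤ 400 * l * (ψ + 1) := by
      have := Nat.lt_mul_div_succ d (show 0 < 400 * l by omega)
      exact this.le
    have hp' : (d:ℝ) ≤ 400 * l * (ψ + 1) := by exact_mod_cast hp
    push_cast
    rw [div_le_iff₀ (by positivity)]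
    have : (t:ℝ) ≤ 400 * l * (t / d) * (ψ + 1) := by
      have : 400 * l * (t / d) * (ψ + 1) = (t:ℝ) * ((400 * l * (ψ + 1)) / d) := by ring
      rw [this]
      exact le_mul_of_one_le_right htR ((one_le_div hdR).2 hp')
    calc ((kap:ℝ) + 4) * t ≤ (kap + 4) * (400 * l * (t / d) * (ψ + 1)) := by gcongr
      _ = _ := by ring
  have hq : (0:ℝ) ≤ t / d := by positivity
  have h2 : (E : ℝ) ≤ (10 ^ 4 * kap : ℝ) * l * t / d := by
    have e1 : (E : ℝ) ≤ 3 * (32 * (t / d)) + 2 * (2 * ((4*kap+18) * (t / d))) +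
        2 * (3 * ((kap+4) * (400 * l * (t / d)))) := by
      rw [hE]; push_cast; push_cast at q1 q2 q3
      linarith
    have e2 : 3 * 32 + 2 * 2 * (4*kap+18) + 2400 * (kap+4) * l ≤ (10 ^ 4 * kap : ℝ) * l := by
      have : (kap:ℝ) ≤ kap * l := le_mul_of_one_le_right (by linarith) hlR
      have : (l:ℝ) ≤ kap * l := le_mul_of_one_le_left (by linarith) hk
      have hk2 : (10^4:ℝ) ≤ kap := by unfold kap; norm_num
      have : (10^4:ℝ) * l ≤ kap * l := by gcongr
      nlinarith
    calc (E:ℝ) ≤ _ := e1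
      _ = (3 * 32 + 2 * 2 * (4*kap+18) + 2400 * (kap+4) * l) * (t / d) := by ring
      _ ≤ ((10 ^ 4 * kap : ℝ) * l) * (t / d) := by gcongr
      _ = _ := by ring
  have hn0 : (0:ℝ) < n := by exact_mod_cast (by omega : 0 < n)
  have hL : 0 ≤ logb 2 (n:ℝ) := Real.logb_nonneg (by norm_num) (by exact_mod_cast (by omega : 1 ≤ n))
  calc (cnt (2 * n) J d t ψ : ℝ) ≤ ((n ^ E : ℕ) : ℝ) := Nat.cast_le.2 h1
    _ = ((2:ℝ) ^ (logb 2 (n:ℝ))) ^ (E:ℝ) := by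
        rw [Real.rpow_logb (by norm_num) (by norm_num) hn0, Real.rpow_natCast]; push_cast; rfl
    _ = (2:ℝ) ^ (logb 2 (n:ℝ) * E) := by rw [Real.rpow_mul (by norm_num)]
    _ ≤ _ := by
        apply Real.rpow_le_rpow_of_exponent_le (by norm_num)
        gcongr

lemma B_bound {n J d t l : ℕ} (hn : 33 ≤ n) (hJ : 2 ^ J ≤ 8 * n) (hd : 1 ≤ d) (hl : 1 ≤ l)
    (hdl : (10 ^ 6 * kap : ℝ) * logb 2 n * l ^ 2 ≤ d) (ht : d ≤ 2 * t) :
    cnt (2 * n) J d t (d / (400 * l)) * (2*(2:ℝ)^((n:ℝ) - t/(50*l))) ≤ 2 * 2 ^ n / n ^ 3 := by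
  have hdR : (0:ℝ) < d := by exact_mod_cast hd
  have hlR : (1:ℝ) ≤ l := by exact_mod_cast hl
  have hk : (1:ℝ) ≤ kap := by unfold kap; norm_num
  have htR : (d:ℝ) ≤ 2 * t := by exact_mod_cast ht
  have hn0 : (0:ℝ) < n := by exact_mod_cast (by omega : 0 < n)
  have hL : 0 ≤ logb 2 (n:ℝ) := Real.logb_nonneg (by norm_num) (by exact_mod_cast (by omega : 1 ≤ n))
  set L := logb 2 (n:ℝ)
  have a1 : L * ((10 ^ 4 * kap : ℝ) * l * t / d) ≤ t / (100 * l) := by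
    rw [← mul_div_assoc, div_le_div_iff₀ hdR (by positivity)]
    have : (10 ^ 6 * kap : ℝ) * L * l ^ 2 * t ≤ d * t := by gcongr
    nlinarith
  have a2 : 3 * L ≤ t / (100 * l) := by
    rw [le_div_iff₀ (by positivity)]
    have h1 : (l:ℝ) * L ≤ l * L * (kap * l) := by
      apply le_mul_of_one_le_right (by positivity)
      nlinarith
    nlinarith [mul_nonneg (show (0:ℝ) ≤ l by positivity) hL]
  have a3 : (t:ℝ) / (50 * l) = t / (100 * l) + t / (100 * l) := by
    field_simp; ring
  calc cnt (2 * n) J d t (d / (400 * l)) * (2*(2:ℝ)^((n:ℝ) - t/(50*l)))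
      ≤ (2 : ℝ) ^ (L * ((10 ^ 4 * kap : ℝ) * l * t / d)) * (2*(2:ℝ)^((n:ℝ) - t/(50*l))) := by
        gcongr; exact cnt_le hn hJ hd hl
    _ = 2 * (2:ℝ) ^ (L * ((10 ^ 4 * kap : ℝ) * l * t / d) + ((n:ℝ) - t/(50*l))) := by
        rw [Real.rpow_add (by norm_num)]; ring
    _ ≤ 2 * (2:ℝ) ^ ((n:ℝ) - L * (3:ℕ)) := by
        gcongr
        · norm_num
        · push_cast; linarith
    _ = 2 * 2 ^ n / n ^ 3 := by
        rw [Real.rpow_sub (by norm_num), Real.rpow_natCast, Real.rpow_mul (by norm_num),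
          Real.rpow_logb (by norm_num) (by norm_num) hn0, Real.rpow_natCast]; ring

open Filter in
lemma ev_sqrt (M : ℝ) : ∀ᶠ x : ℝ in atTop, M * (logb 2 x + 7) ^ 2 ≤ √x := by
  have h1 : (fun x : ℝ => (logb 2 x + 7)) =o[atTop] (fun x => x ^ ((1:ℝ)/4)) := by
    apply Asymptotics.IsLittleO.add
    · have h := (isLittleO_log_rpow_atTop (show (0:ℝ) < 1/4 by norm_num)).const_mul_left (log 2)⁻¹
      refine h.congr_left (fun x => ?_)
      rw [logb, div_eq_inv_mul]
    · rw [Asymptotics.isLittleO_const_left]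
      right
      exact tendsto_norm_atTop_atTop.comp (tendsto_rpow_atTop (by norm_num))
  have hpos : 0 < (1 + |M|)⁻¹ := by positivity
  have h2 := (h1.pow (n := 2) (by norm_num)).def hpos
  filter_upwards [h2, eventually_ge_atTop 1] with x hx hx1
  have e : (x ^ ((1:ℝ)/4)) ^ 2 = √x := by
    rw [← Real.rpow_natCast, ← Real.rpow_mul (by linarith), Real.sqrt_eq_rpow]; norm_num
  rw [e, Real.norm_of_nonneg (by positivity), Real.norm_of_nonneg (by positivity)] at hx
  have hM : M ≤ 1 + |M| := by have := le_abs_self M; linarith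
  calc M * (logb 2 x + 7) ^ 2 ≤ (1 + |M|) * (logb 2 x + 7) ^ 2 := by gcongr
    _ ≤ (1 + |M|) * ((1 + |M|)⁻¹ * √x) := by gcongr
    _ = √x := by field_simp

open Filter in
lemma ev_d (M : ℝ) (hM : 0 ≤ M) : ∃ n₀ : ℕ, ∀ n : ℕ, n₀ ≤ n → ∀ d : ℕ,
    logb 2 n * (logb 2 (logb 2 n)) ^ (11 : ℕ) ≤ d →
    1 ≤ d ∧ M * logb 2 n * ((Nat.log 2 d + 7 : ℕ) : ℝ) ^ 2 ≤ d := by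
  obtain ⟨X, hX⟩ := eventually_atTop.1 (ev_sqrt M)
  have hT : Tendsto (fun n : ℕ => logb 2 (n:ℝ)) atTop atTop :=
    (Real.tendsto_logb_atTop (by norm_num)).comp tendsto_natCast_atTop_atTop
  have hT2 : Tendsto (fun n : ℕ => logb 2 (logb 2 (n:ℝ))) atTop atTop :=
    (Real.tendsto_logb_atTop (by norm_num)).comp hT
  have hev := (hT.eventually_ge_atTop (max X 1)).and (hT2.eventually_ge_atTop (max (9 * M) 7))
  obtain ⟨n₀, hn₀⟩ := eventually_atTop.1 hev
  refine ⟨n₀, fun n hn d hd => ?_⟩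
  obtain ⟨hL, hLL⟩ := hn₀ n hn
  set L := logb 2 (n:ℝ)
  set Λ := logb 2 L
  have hLX := (le_max_left _ _).trans hL
  have hL1 := (le_max_right _ _).trans hL
  have hΛM := (le_max_left _ _).trans hLL
  have hΛ7 := (le_max_right _ _).trans hLL
  have hΛ1 : (1:ℝ) ≤ Λ := by linarith
  have hLd : L ≤ d := le_trans (le_mul_of_one_le_right (by linarith) (one_le_pow₀ hΛ1)) hd
  have hd1 : (1:ℝ) ≤ d := hL1.trans hLd
  have hd1' : 1 ≤ d := by exact_mod_cast hd1
  refine ⟨hd1', ?_⟩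
  have hlog : ((Nat.log 2 d + 7 : ℕ) : ℝ) ≤ logb 2 d + 7 := by
    have := Real.natLog_le_logb d 2
    push_cast at this ⊢; linarith
  have hlog0 : 0 ≤ logb 2 (d:ℝ) := Real.logb_nonneg (by norm_num) hd1
  have step : M * L * ((Nat.log 2 d + 7 : ℕ) : ℝ) ^ 2 ≤ M * L * (logb 2 d + 7) ^ 2 := by
    gcongr
  refine step.trans ?_
  rcases le_total (L ^ 2) (d:ℝ) with h | h
  · have h1 := hX d (hLX.trans hLd)
    have h2 : L ≤ √d := Real.le_sqrt_of_sq_le h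
    calc M * L * (logb 2 d + 7) ^ 2 = L * (M * (logb 2 d + 7) ^ 2) := by ring
      _ ≤ √d * √d := by gcongr
      _ = d := Real.mul_self_sqrt (by linarith)
  · have h1 : logb 2 (d:ℝ) ≤ 2 * Λ := by
      have := Real.logb_le_logb_of_le (b := 2) (by norm_num) (by linarith) h
      rw [Real.logb_pow] at this
      exact_mod_cast this
    calc M * L * (logb 2 d + 7) ^ 2 ≤ M * L * (3 * Λ) ^ 2 := by gcongr; linarith
      _ = L * ((9 * M) * Λ ^ 2) := by ring
      _ ≤ L * (Λ * Λ ^ 2) := by gcongr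
      _ = L * Λ ^ 3 := by ring
      _ ≤ L * Λ ^ 11 := by gcongr; norm_num
      _ ≤ d := hd

lemma main_bound : ∀ ε : ℝ, 0 < ε → ∃ n₀ : ℕ, ∀ n : ℕ, n₀ ≤ n →
      ∀ (F : Type) [AddCommGroup F] [Fintype F] [DecidableEq F],
        Fintype.card F = 2 * n →
        ∀ D : Finset F, (∀ x ∈ D, -x ∈ D) → (0 : F) ∉ D →
          AddSubgroup.closure (D : Set F) = ⊤ →
          logb 2 n * (logb 2 (logb 2 n)) ^ (11 : ℕ) ≤ (#D : ℝ) →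
          (#(inds D univ) : ℝ) ≤ (1 + ε) * 2 ^ (n + 1) := by
  intro ε hε
  obtain ⟨n₁, hn₁⟩ := ev_d (10 ^ 6 * kap) (by positivity)
  refine ⟨n₁ + 33 + ⌈ε⁻¹⌉₊, fun n hn F _ _ _ hN D hs h0 hgen hd => ?_⟩
  obtain ⟨hd1, hdl⟩ := hn₁ n (by omega) #D hd
  have hn33 : 33 ≤ n := by omega
  have hD : D.Nonempty := card_pos.1 hd1
  obtain ⟨J, hJ, hJ', hJn⟩ := exists_J hs hD hN (by omega)
  have hl2 : 64 * #D ≤ 2 ^ (Nat.log 2 #D + 7) := by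
    have := Nat.lt_pow_succ_log_self (b := 2) (by norm_num) #D
    have e : 2 ^ (Nat.log 2 #D + 7) = 64 * 2 ^ (Nat.log 2 #D + 1) := by
      rw [pow_add, pow_add]; ring
    rw [e]; simp only [Nat.succ_eq_add_one] at this; omega
  have hl : 1 ≤ Nat.log 2 #D + 7 := by omega
  have key := count_total hs hD h0 hgen hN hl hl2 (Nat.div_mul_le_self _ _) hJ hJ'
    (2 * 2 ^ n / n ^ 3) (by positivity) (fun t ht => B_bound hn33 hJn hd1 hl hdl ht)
  refine key.trans ?_
  have hnε : ε⁻¹ ≤ n := (Nat.le_ceil _).trans (by exact_mod_cast (by omega : ⌈ε⁻¹⌉₊ ≤ n))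
  have hnR : (33:ℝ) ≤ n := by exact_mod_cast hn33
  have h1 : 1 ≤ ε * n := by
    have := mul_le_mul_of_nonneg_left hnε hε.le
    rwa [mul_inv_cancel₀ hε.ne'] at this
  have h2 : ((2:ℝ) * n + 1) / n ^ 3 ≤ ε := by
    rw [div_le_iff₀ (by positivity)]
    calc (2:ℝ) * n + 1 ≤ 1 * n ^ 2 := by nlinarith
      _ ≤ (ε * n) * n ^ 2 := by gcongr
      _ = _ := by ring
  calc (2:ℝ) ^ (n + 1) + (2 * n + 1) * (2 * 2 ^ n / n ^ 3)
      = 2 ^ (n + 1) + ((2:ℝ) * n + 1) / n ^ 3 * 2 ^ (n + 1) := by ring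
    _ ≤ 2 ^ (n + 1) + ε * 2 ^ (n + 1) := by gcongr
    _ = _ := by ring

end ACG

theorem stmt0 :
    ∃ C : ℝ, 0 < C ∧ ∀ ε : ℝ, 0 < ε → ∃ n₀ : ℕ, ∀ n : ℕ, n₀ ≤ n →
      ∀ (F : Type) [AddCommGroup F] [Fintype F],
        Fintype.card F = 2 * n →
        ∀ D : Set F, (∀ x ∈ D, -x ∈ D) → (0 : F) ∉ D →
          AddSubgroup.closure D = ⊤ →
          (cayleyGraph D).Connected →
          C * logb 2 n * (logb 2 (logb 2 n)) ^ (11 : ℕ) ≤ (D.ncard : ℝ) →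
          (numIndSets (cayleyGraph D) : ℝ) ≤ (1 + ε) * 2 ^ (n + 1) := by
  classical
  refine ⟨1, one_pos, fun ε hε => ?_⟩
  obtain ⟨n₀, h⟩ := ACG.main_bound ε hε
  refine ⟨n₀, fun n hn F _ _ hN D hs h0 hgen _ hd => ?_⟩
  rw [Set.ncard_eq_toFinset_card' D, one_mul] at hd
  have key := h n hn F hN D.toFinset (by simpa using hs) (by simpa using h0)
    (by rw [Set.coe_toFinset]; exact hgen) hd
  refine le_trans ?_ key
  have hle : numIndSets (cayleyGraph D) ≤ (ACG.inds D.toFinset Finset.univ).card := by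
    have e : (ACG.inds D.toFinset Finset.univ).card =
      Nat.card (ACG.inds D.toFinset Finset.univ) := by simp
    rw [e, numIndSets]
    refine Nat.card_le_card_of_injective
      (fun s => ⟨s.1.toFinset, Finset.mem_filter.2 ⟨by simp, ?_⟩⟩) ?_
    · intro x hx y hy hxy
      rw [Set.mem_toFinset] at hx hy hxy
      refine s.2 hx hy ?_
      rw [cayleyGraph, SimpleGraph.fromRel_adj]
      refine ⟨?_, Or.inl hxy⟩
      rintro rfl
      rw [sub_self] at hxy
      exact h0 hxy
    · intro s s' hss
      exact Subtype.ext (Set.toFinset_inj.1 (congrArg Subtype.val hss))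
  exact_mod_cast hle
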